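/- arXiv:1407.6848 — 2 statements merged into one kernel-verified Lean document; each statement's English description precedes it below -/
import Mathlib

section
/- Let F be a cumulative distribution function on ℝ with finite mean μ whose residual distribution F̃ has finite second moment. Then there exist random variables X_i, i ∈ ℕ, each with distribution F, and Z with distribution F̃, such that Var(S_n) ≤ E[Z²]/4 for all n ∈ ℕ, where S_n = X₁ + ⋯ + X_n. In particular: (a) if F is supported on [a,b], a,b ∈ ℝ, then Var(S_n) ≤ (b−a)²/4 for all n; (b) if F has finite third absolute moment, then there is a constant C not depending on n with Var(S_n) ≤ C for all n. -/
open MeasureTheory ProbabilityTheory Set Filter Topology Asymptotics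

noncomputable section

/-- Generalized inverse `F⁻¹` of the CDF of the distribution `ν`:
`F⁻¹(t) = inf {x | F(x) ≥ t}` for `t ≠ 0` and `F⁻¹(0) = inf {x | F(x) > 0}`. -/
def qf (ν : Measure ℝ) (t : ℝ) : ℝ :=
  if t = 0 then sInf {x : ℝ | 0 < (ν (Iic x)).toReal}
  else sInf {x : ℝ | t ≤ (ν (Iic x)).toReal}

/-- `H(s) = ∫₀ˢ (F⁻¹(t) − μ) dt`. -/
def Hfun (ν : Measure ℝ) (μ : ℝ) (s : ℝ) : ℝ := ∫ t in (0:ℝ)..s, (qf ν t - μ)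

/-- `ν = F(μ−)`. -/
def nuM (ν : Measure ℝ) (μ : ℝ) : ℝ := (ν (Iio μ)).toReal

/-- `ν⁺ = F(μ)`. -/
def nuP (ν : Measure ℝ) (μ : ℝ) : ℝ := (ν (Iic μ)).toReal

/-- `c = H(ν)`, the minimum value of `H`. -/
def cval (ν : Measure ℝ) (μ : ℝ) : ℝ := Hfun ν μ (nuM ν μ)

/-- `A : [c,0] → [0,ν]`, the inverse of `H` on `[0,ν)`, with `A(c) = ν⁺`. -/
def Afun (ν : Measure ℝ) (μ : ℝ) (s : ℝ) : ℝ :=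
  if s = cval ν μ then nuP ν μ
  else sInf {t : ℝ | t ∈ Icc 0 (nuM ν μ) ∧ Hfun ν μ t ≤ s}

/-- `B : [c,0] → [ν⁺,1]`, the inverse of `H` on `(ν⁺,1]`, with `B(c) = ν⁺`. -/
def Bfun (ν : Measure ℝ) (μ : ℝ) (s : ℝ) : ℝ :=
  if s = cval ν μ then nuP ν μ
  else sInf {t : ℝ | t ∈ Icc (nuP ν μ) 1 ∧ s ≤ Hfun ν μ t}

/-- The distribution function `K`, supported on `[c,0]`. -/
def Kfun (ν : Measure ℝ) (μ : ℝ) (s : ℝ) : ℝ :=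
  if 0 < s then 1
  else if s < cval ν μ then 0
  else if s = cval ν μ then nuP ν μ - nuM ν μ
  else Bfun ν μ s - Afun ν μ s

/-- `u(s) = (μ − F⁻¹(A(s))) / (F⁻¹(B(s)) − F⁻¹(A(s)))` for `s ∈ (c,0)`, `u(c) = 1/2`. -/
def ufun (ν : Measure ℝ) (μ : ℝ) (s : ℝ) : ℝ :=
  if s = cval ν μ then 1/2
  else (μ - qf ν (Afun ν μ s)) / (qf ν (Bfun ν μ s) - qf ν (Afun ν μ s))

/-- Generalized inverse of the distribution function `K`. -/
def Kinv (ν : Measure ℝ) (μ : ℝ) (t : ℝ) : ℝ := sInf {s : ℝ | t ≤ Kfun ν μ s}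

/-- The map `t ↦ F⁻¹(B(Y(t))) − F⁻¹(A(Y(t)))` where `Y = K⁻¹` is the quantile
transform of `K`; applied to a uniform random variable it realizes the residual
distribution of `F`. -/
def residualRV (ν : Measure ℝ) (μ : ℝ) (t : ℝ) : ℝ :=
  qf ν (Bfun ν μ (Kinv ν μ t)) - qf ν (Afun ν μ (Kinv ν μ t))

/-- The residual distribution `F̃` of `F`: the law of `F⁻¹(B(Y)) − F⁻¹(A(Y))`
for `Y ∼ K`. -/
def residualDist (ν : Measure ℝ) (μ : ℝ) : Measure ℝ :=
  Measure.map (residualRV ν μ) (volume.restrict (Icc (0:ℝ) 1))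

end

theorem floor_add_eq_ite (r : ℝ) {v : ℝ} (hv : v ∈ Ico (0:ℝ) 1) :
    ⌊v + r⌋ = if v < 1 - Int.fract r then ⌊r⌋ else ⌊r⌋ + 1 := by
  have h1 := Int.floor_add_fract r
  have h2 := Int.fract_nonneg r
  have h3 := Int.fract_lt_one r
  obtain ⟨h4, h5⟩ := hv
  split_ifs with h <;> rw [Int.floor_eq_iff] <;> push_cast <;> constructor <;> linarith

theorem integral_comp_floor_add (g : ℤ → ℝ) (r : ℝ) :
    Integrable (fun v : ℝ => g ⌊v + r⌋) (volume.restrict (Icc (0:ℝ) 1)) ∧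
    ∫ v in Icc (0:ℝ) 1, g ⌊v + r⌋ =
      (1 - Int.fract r) * g ⌊r⌋ + Int.fract r * g (⌊r⌋ + 1) := by
  have h2 := Int.fract_nonneg r
  have h3 := Int.fract_lt_one r
  have hae : (fun v : ℝ => g ⌊v + r⌋) =ᵐ[volume.restrict (Icc (0:ℝ) 1)]
      fun v => g ⌊r⌋ + (Ici (1 - Int.fract r)).indicator
        (fun _ => g (⌊r⌋ + 1) - g ⌊r⌋) v := by
    rw [← restrict_Ico_eq_restrict_Icc]
    filter_upwards [ae_restrict_mem measurableSet_Ico] with v hv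
    rw [floor_add_eq_ite r hv]
    by_cases h : v < 1 - Int.fract r
    · simp only [h, if_true, indicator, mem_Ici, not_le.2 h, if_false, add_zero]
    · simp only [h, if_false, indicator, mem_Ici, not_lt.1 h, if_true]
      ring
  have hI : Integrable ((Ici (1 - Int.fract r)).indicator
        (fun _ => g (⌊r⌋ + 1) - g ⌊r⌋)) (volume.restrict (Icc (0:ℝ) 1)) :=
    (integrable_const _).indicator measurableSet_Ici
  refine ⟨((integrable_const _).add hI).congr hae.symm, ?_⟩
  rw [integral_congr_ae hae, integral_add (integrable_const _) hI,
    integral_indicator measurableSet_Ici, Measure.restrict_restrict measurableSet_Ici]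
  have : Ici (1 - Int.fract r) ∩ Icc (0:ℝ) 1 = Icc (1 - Int.fract r) 1 := by
    ext x; simp only [mem_inter_iff, mem_Ici, mem_Icc]
    constructor
    · rintro ⟨h, _, h'⟩; exact ⟨h, h'⟩
    · rintro ⟨h, h'⟩; exact ⟨h, by linarith, h'⟩
  rw [this]
  simp [h2]
  ring

theorem integral_floor_add_sub_sq_le (r : ℝ) :
    Integrable (fun v : ℝ => ((⌊v + r⌋ : ℝ) - r) ^ 2) (volume.restrict (Icc (0:ℝ) 1)) ∧
    ∫ v in Icc (0:ℝ) 1, ((⌊v + r⌋ : ℝ) - r) ^ 2 ≤ 1 / 4 := by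
  obtain ⟨h1, h2⟩ := integral_comp_floor_add (fun k => ((k:ℝ) - r) ^ 2) r
  refine ⟨h1, h2.trans_le ?_⟩
  have h := Int.floor_add_fract r
  have : (⌊r⌋ : ℝ) = r - Int.fract r := by linarith
  push_cast
  rw [this]
  nlinarith [sq_nonneg (Int.fract r - 1 / 2)]

theorem floor_add_sub_floor_mem {u : ℝ} (h0 : 0 ≤ u) (h1 : u ≤ 1) (x : ℝ) :
    ⌊x + u⌋ - ⌊x⌋ = 0 ∨ ⌊x + u⌋ - ⌊x⌋ = 1 := by
  have h2 : ⌊x⌋ ≤ ⌊x + u⌋ := Int.floor_mono (by linarith)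
  have h3 : ⌊x + u⌋ ≤ ⌊x⌋ + 1 := by
    rw [← Int.floor_add_one]; exact Int.floor_mono (by linarith)
  omega

theorem volume_floor_add_sub_floor_eq_one {u : ℝ} (h0 : 0 ≤ u) (h1 : u ≤ 1) (r : ℝ) :
    volume.restrict (Icc (0:ℝ) 1) {v : ℝ | ⌊v + r + u⌋ - ⌊v + r⌋ = 1} = ENNReal.ofReal u := by
  obtain ⟨i1, e1⟩ := integral_comp_floor_add (fun k => (k : ℝ)) (r + u)
  obtain ⟨i2, e2⟩ := integral_comp_floor_add (fun k => (k : ℝ)) r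
  have hm : MeasurableSet {v : ℝ | ⌊v + r + u⌋ - ⌊v + r⌋ = 1} :=
    measurableSet_eq_fun (by fun_prop) measurable_const
  rw [← ofReal_measureReal, ← integral_indicator_one hm]
  congr 1
  have : ∀ v : ℝ, {v : ℝ | ⌊v + r + u⌋ - ⌊v + r⌋ = 1}.indicator (1 : ℝ → ℝ) v =
      (⌊v + (r + u)⌋ : ℝ) - ⌊v + r⌋ := by
    intro v
    rw [← Int.cast_sub, ← add_assoc]
    rcases floor_add_sub_floor_mem h0 h1 (v + r) with h | h <;> simp [indicator, h]
  simp_rw [this]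
  rw [integral_sub i1 i2, e1, e2]
  have h3 := Int.floor_add_fract r
  have h4 := Int.floor_add_fract (r + u)
  push_cast
  linarith

theorem exists_variance_sum_le_of_two_point_mixture
    (κ ν : Measure ℝ) [IsProbabilityMeasure κ] {a b : ℝ → ℝ} (μ : ℝ)
    (ha : Measurable a) (hb : Measurable b) (haμ : ∀ s, a s ≤ μ) (hμb : ∀ s, μ ≤ b s)
    (hi : Integrable (fun s => (b s - a s) ^ 2) κ)
    (hν : ∀ S : Set ℝ, MeasurableSet S →
      ∫⁻ s, (ENNReal.ofReal ((μ - a s) / (b s - a s)) * S.indicator 1 (b s) +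
        ENNReal.ofReal (1 - (μ - a s) / (b s - a s)) * S.indicator 1 (a s)) ∂κ = ν S) :
    ∃ X : ℕ → ℝ × ℝ → ℝ,
      (∀ i, Measure.map (X i) (κ.prod (volume.restrict (Icc (0:ℝ) 1))) = ν) ∧
      ∀ n : ℕ, variance (fun ω => ∑ i ∈ Finset.range n, X i ω)
        (κ.prod (volume.restrict (Icc (0:ℝ) 1))) ≤ (∫ s, (b s - a s) ^ 2 ∂κ) / 4 := by
  set u : ℝ → ℝ := fun s => (μ - a s) / (b s - a s) with hu
  have hum : Measurable u := by fun_prop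
  have hu0 : ∀ s, 0 ≤ u s := fun s =>
    div_nonneg (by linarith [haμ s]) (by linarith [haμ s, hμb s])
  have hu1 : ∀ s, u s ≤ 1 := fun s =>
    div_le_one_of_le₀ (by linarith [hμb s]) (by linarith [haμ s, hμb s])
  have hmean : ∀ s, u s * (b s - a s) = μ - a s := by
    intro s
    rcases eq_or_ne (b s - a s) 0 with h | h
    · rw [h, mul_zero]; linarith [haμ s, hμb s]
    · exact div_mul_cancel₀ _ h
  have hprob : IsProbabilityMeasure (volume.restrict (Icc (0:ℝ) 1)) := ⟨by simp⟩
  refine ⟨fun i ω => a ω.1 + (b ω.1 - a ω.1) *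
    ((⌊ω.2 + i * u ω.1 + u ω.1⌋ - ⌊ω.2 + i * u ω.1⌋ : ℤ) : ℝ), fun i => ?_, fun n => ?_⟩
  · have hX : Measurable (fun ω : ℝ × ℝ => a ω.1 + (b ω.1 - a ω.1) *
        ((⌊ω.2 + i * u ω.1 + u ω.1⌋ - ⌊ω.2 + i * u ω.1⌋ : ℤ) : ℝ)) := by
      push_cast; fun_prop
    ext S hS
    rw [Measure.map_apply hX hS, Measure.prod_apply (hX hS), ← hν S hS]
    refine lintegral_congr fun s => ?_
    set D : Set ℝ := {v : ℝ | ⌊v + i * u s + u s⌋ - ⌊v + i * u s⌋ = 1} with hD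
    have hDm : MeasurableSet D := measurableSet_eq_fun (by fun_prop) measurable_const
    have hDv : volume.restrict (Icc (0:ℝ) 1) D = ENNReal.ofReal (u s) :=
      volume_floor_add_sub_floor_eq_one (hu0 s) (hu1 s) _
    have hDc : volume.restrict (Icc (0:ℝ) 1) Dᶜ = ENNReal.ofReal (1 - u s) := by
      rw [prob_compl_eq_one_sub hDm, hDv, ENNReal.ofReal_sub _ (hu0 s), ENNReal.ofReal_one]
    rw [← measure_inter_add_sdiff _ hDm]
    congr 1
    · rw [← hDv]
      by_cases h : b s ∈ S
      · simp only [h, indicator_of_mem, Pi.one_apply, mul_one]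
        congr 1
        ext v
        simp only [mem_inter_iff, mem_preimage, and_iff_right_iff_imp]
        intro hv
        rw [hv]; simpa using h
      · simp only [h, not_false_eq_true, indicator_of_notMem, mul_zero]
        convert measure_empty (μ := volume.restrict (Icc (0:ℝ) 1))
        ext v
        simp only [mem_inter_iff, mem_preimage, mem_empty_iff_false, iff_false, not_and]
        intro h1 hv
        rw [hv] at h1; simp [h] at h1
    · rw [← hDc]
      have hz : ∀ v ∈ Dᶜ, ⌊v + i * u s + u s⌋ - ⌊v + i * u s⌋ = 0 := fun v hv =>
        (floor_add_sub_floor_mem (hu0 s) (hu1 s) _).resolve_right hv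
      by_cases h : a s ∈ S
      · simp only [h, indicator_of_mem, Pi.one_apply, mul_one]
        congr 1
        ext v
        simp only [Set.mem_sdiff, mem_preimage, mem_compl_iff, and_iff_right_iff_imp]
        intro hv
        rw [hz v hv]; simpa using h
      · simp only [h, not_false_eq_true, indicator_of_notMem, mul_zero]
        convert measure_empty (μ := volume.restrict (Icc (0:ℝ) 1))
        ext v
        simp only [Set.mem_sdiff, mem_preimage, mem_empty_iff_false, iff_false, not_and, not_not]
        intro h1
        by_contra hv
        rw [hz v hv] at h1; simp [h] at h1
  · have hsum : ∀ ω : ℝ × ℝ, ∑ i ∈ Finset.range n, (a ω.1 + (b ω.1 - a ω.1) *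
        ((⌊ω.2 + i * u ω.1 + u ω.1⌋ - ⌊ω.2 + i * u ω.1⌋ : ℤ) : ℝ)) =
        n * a ω.1 + (b ω.1 - a ω.1) * ((⌊ω.2 + n * u ω.1⌋ : ℝ) - ⌊ω.2⌋) := by
      intro ω
      rw [Finset.sum_add_distrib, ← Finset.mul_sum]
      congr 1
      · simp
      · congr 1
        have := Finset.sum_range_sub (fun i : ℕ => (⌊ω.2 + i * u ω.1⌋ : ℝ)) n
        simp only [Nat.cast_zero, zero_mul, add_zero] at this
        rw [← this]
        refine Finset.sum_congr rfl fun i _ => ?_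
        push_cast
        rw [add_mul, one_mul, add_assoc]
    simp_rw [hsum]
    set T : ℝ × ℝ → ℝ := fun ω =>
      n * a ω.1 + (b ω.1 - a ω.1) * ((⌊ω.2 + n * u ω.1⌋ : ℝ) - ⌊ω.2⌋) with hT
    have hTm : Measurable T := by fun_prop
    have hae : ∀ᵐ ω ∂(κ.prod (volume.restrict (Icc (0:ℝ) 1))),
        (T ω - n * μ) ^ 2 = (b ω.1 - a ω.1) ^ 2 * ((⌊ω.2 + n * u ω.1⌋ : ℝ) - n * u ω.1) ^ 2 := by
      have h0 : ∀ᵐ v ∂(volume.restrict (Icc (0:ℝ) 1)), v ∈ Ico (0:ℝ) 1 := by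
        rw [← restrict_Ico_eq_restrict_Icc]
        exact ae_restrict_mem measurableSet_Ico
      filter_upwards [Measure.quasiMeasurePreserving_snd.ae h0] with ω hω
      have : ⌊ω.2⌋ = 0 := Int.floor_eq_zero_iff.2 hω
      have h5 := hmean ω.1
      simp only [hT, this]
      push_cast
      rw [← mul_pow]
      congr 1
      linear_combination (n : ℝ) * h5
    rw [← variance_sub_const hTm.aestronglyMeasurable (n * μ)]
    refine (variance_le_expectation_sq (by fun_prop)).trans ?_
    have : ∫ ω, (T ω - n * μ) ^ 2 ∂(κ.prod (volume.restrict (Icc (0:ℝ) 1))) =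
        ∫ ω, (b ω.1 - a ω.1) ^ 2 * ((⌊ω.2 + n * u ω.1⌋ : ℝ) - n * u ω.1) ^ 2
          ∂(κ.prod (volume.restrict (Icc (0:ℝ) 1))) := integral_congr_ae hae
    refine this.trans_le ?_
    have hI : Integrable (fun ω : ℝ × ℝ =>
        (b ω.1 - a ω.1) ^ 2 * ((⌊ω.2 + n * u ω.1⌋ : ℝ) - n * u ω.1) ^ 2)
        (κ.prod (volume.restrict (Icc (0:ℝ) 1))) := by
      refine (hi.comp_fst (volume.restrict (Icc (0:ℝ) 1))).mono
        (Measurable.aestronglyMeasurable (by fun_prop)) ?_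
      filter_upwards [Measure.quasiMeasurePreserving_snd.ae
        (ae_restrict_mem (μ := (volume : Measure ℝ)) (measurableSet_Icc (a := 0) (b := 1)))]
        with ω hω
      rw [norm_mul]
      refine mul_le_of_le_one_right (norm_nonneg _) ?_
      rw [Real.norm_of_nonneg (sq_nonneg _), sq_le_one_iff_abs_le_one, abs_le]
      have h1 := Int.floor_le (ω.2 + n * u ω.1)
      have h2 := Int.lt_floor_add_one (ω.2 + n * u ω.1)
      constructor <;> linarith [hω.1, hω.2]
    rw [← integral_div, integral_prod _ hI]
    refine integral_mono hI.integral_prod_left (hi.div_const 4) fun s => ?_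
    simp only [integral_const_mul]
    rw [div_eq_mul_one_div]
    exact mul_le_mul_of_nonneg_left (integral_floor_add_sub_sq_le _).2 (sq_nonneg _)

theorem sInf_le_iff_le_measure_Iic (ν : Measure ℝ) [IsProbabilityMeasure ν] {t : ℝ}
    (ht : t ∈ Ioo (0:ℝ) 1) (x : ℝ) :
    sInf {y : ℝ | t ≤ (ν (Iic y)).toReal} ≤ x ↔ t ≤ (ν (Iic x)).toReal := by
  have hF : ∀ y, (ν (Iic y)).toReal = cdf ν y := fun y => (cdf_eq_real ν y).symm
  simp only [hF]
  have hne : {y : ℝ | t ≤ cdf ν y}.Nonempty :=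
    ((tendsto_cdf_atTop ν).eventually (eventually_ge_nhds ht.2)).exists
  have hbdd : BddBelow {y : ℝ | t ≤ cdf ν y} := by
    obtain ⟨z, hz⟩ := ((tendsto_cdf_atBot ν).eventually (eventually_lt_nhds ht.1)).exists
    refine ⟨z, fun y hy => ?_⟩
    by_contra! h
    exact absurd (monotone_cdf ν h.le) (not_le.2 (hz.trans_le hy))
  refine ⟨fun h => ?_, fun h => csInf_le hbdd h⟩
  have hlim : Tendsto (cdf ν) (𝓝[>] x) (𝓝 (cdf ν x)) :=
    ((cdf ν).right_continuous x).tendsto.mono_left (nhdsWithin_mono _ Ioi_subset_Ici_self)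
  refine ge_of_tendsto hlim ?_
  filter_upwards [self_mem_nhdsWithin] with y hy
  obtain ⟨z, hz, hzy⟩ := exists_lt_of_csInf_lt hne (lt_of_le_of_lt h hy)
  exact le_trans hz (monotone_cdf ν hzy.le)

theorem monotoneOn_of_le_iff_le_measure_Iic {ν : Measure ℝ} {q : ℝ → ℝ}
    (hq : ∀ t ∈ Ioo (0:ℝ) 1, ∀ x, q t ≤ x ↔ t ≤ (ν (Iic x)).toReal) :
    MonotoneOn q (Ioo 0 1) := fun s hs t ht hst =>
  (hq s hs _).2 (hst.trans ((hq t ht _).1 le_rfl))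

theorem aemeasurable_of_le_iff_le_measure_Iic {ν : Measure ℝ} {q : ℝ → ℝ}
    (hq : ∀ t ∈ Ioo (0:ℝ) 1, ∀ x, q t ≤ x ↔ t ≤ (ν (Iic x)).toReal) :
    AEMeasurable q (volume.restrict (Icc (0:ℝ) 1)) := by
  rw [← restrict_Ioo_eq_restrict_Icc]
  exact aemeasurable_restrict_of_monotoneOn measurableSet_Ioo
    (monotoneOn_of_le_iff_le_measure_Iic hq)

theorem ae_restrict_Icc_mem_Ioo :
    ∀ᵐ t ∂(volume.restrict (Icc (0:ℝ) 1)), t ∈ Ioo (0:ℝ) 1 := by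
  rw [← restrict_Ioo_eq_restrict_Icc]
  exact ae_restrict_mem measurableSet_Ioo

theorem map_eq_of_le_iff_le_measure_Iic {ν : Measure ℝ} [IsProbabilityMeasure ν] {q : ℝ → ℝ}
    (hq : ∀ t ∈ Ioo (0:ℝ) 1, ∀ x, q t ≤ x ↔ t ≤ (ν (Iic x)).toReal) :
    Measure.map q (volume.restrict (Icc (0:ℝ) 1)) = ν := by
  have hm := aemeasurable_of_le_iff_le_measure_Iic hq
  refine Measure.ext_of_Iic _ _ fun x => ?_
  have h : q ⁻¹' Iic x =ᵐ[volume.restrict (Icc (0:ℝ) 1)] Iic (ν (Iic x)).toReal := by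
    filter_upwards [ae_restrict_Icc_mem_Ioo] with t ht
    exact propext (hq t ht x)
  rw [Measure.map_apply_of_aemeasurable hm measurableSet_Iic, measure_congr h,
    Measure.restrict_apply measurableSet_Iic, inter_comm, ← Ici_inter_Iic,
    inter_assoc, Iic_inter_Iic, min_eq_right (show (ν (Iic x)).toReal ≤ 1 from measureReal_le_one),
    Ici_inter_Iic, Real.volume_Icc, sub_zero,
    ENNReal.ofReal_toReal (measure_ne_top _ _)]

theorem qf_le_iff (ν : Measure ℝ) [IsProbabilityMeasure ν] {t : ℝ}
    (ht : t ∈ Ioo (0:ℝ) 1) (x : ℝ) : qf ν t ≤ x ↔ t ≤ (ν (Iic x)).toReal := by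
  rw [qf, if_neg ht.1.ne', sInf_le_iff_le_measure_Iic ν ht]

theorem qf_eq_zero_of_notMem (ν : Measure ℝ) [IsProbabilityMeasure ν] {t : ℝ}
    (ht : t ∉ Icc (0:ℝ) 1) : qf ν t = 0 := by
  rw [mem_Icc, not_and_or, not_le, not_le] at ht
  rcases ht with ht | ht
  · rw [qf, if_neg ht.ne, ← Real.sInf_univ]
    congr 1
    exact eq_univ_of_forall fun x => ht.le.trans ENNReal.toReal_nonneg
  · rw [qf, if_neg (by linarith), ← Real.sInf_empty]
    congr 1
    refine eq_empty_of_forall_notMem fun x hx => ?_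
    have : ν.real (Iic x) ≤ 1 := measureReal_le_one
    exact absurd (ht.trans_le hx) (not_lt.2 this)

theorem nuM_mem_Icc (ν : Measure ℝ) [IsProbabilityMeasure ν] (μ : ℝ) :
    nuM ν μ ∈ Icc (0:ℝ) 1 := ⟨ENNReal.toReal_nonneg, measureReal_le_one⟩

theorem nuP_mem_Icc (ν : Measure ℝ) [IsProbabilityMeasure ν] (μ : ℝ) :
    nuP ν μ ∈ Icc (0:ℝ) 1 := ⟨ENNReal.toReal_nonneg, measureReal_le_one⟩

theorem nuM_le_nuP (ν : Measure ℝ) [IsProbabilityMeasure ν] (μ : ℝ) : nuM ν μ ≤ nuP ν μ :=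
  measureReal_mono Iio_subset_Iic_self

theorem qf_lt_of_lt_nuM (ν : Measure ℝ) [IsProbabilityMeasure ν] {μ t : ℝ}
    (ht : t ∈ Ioo (0:ℝ) 1) (h : t < nuM ν μ) : qf ν t < μ := by
  have hlim : Tendsto (fun x => ν.real (Iic x)) (𝓝[<] μ) (𝓝 (ν.real (Iio μ))) := by
    have h1 := (cdf ν).mono.tendsto_leftLim μ
    have h2 : ν (Iio μ) = ENNReal.ofReal (Function.leftLim (cdf ν) μ) := by
      conv_lhs => rw [← measure_cdf ν]
      rw [StieltjesFunction.measure_Iio _ (tendsto_cdf_atBot ν), sub_zero]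
    have h3 : 0 ≤ Function.leftLim (cdf ν) μ :=
      (cdf_nonneg ν (μ - 1)).trans ((monotone_cdf ν).le_leftLim (by linarith))
    rw [measureReal_def, h2, ENNReal.toReal_ofReal h3]
    exact h1.congr fun x => cdf_eq_real ν x
  obtain ⟨x, hx1, hx2⟩ := ((hlim.eventually (eventually_gt_nhds h)).and
    self_mem_nhdsWithin).exists
  exact lt_of_le_of_lt ((qf_le_iff ν ht x).2 hx1.le) hx2

theorem qf_eq_of_mem_Ioc (ν : Measure ℝ) [IsProbabilityMeasure ν] {μ t : ℝ}
    (ht : t ∈ Ioo (0:ℝ) 1) (h : t ∈ Ioc (nuM ν μ) (nuP ν μ)) : qf ν t = μ := by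
  refine le_antisymm ((qf_le_iff ν ht μ).2 h.2) ?_
  by_contra! hlt
  have h1 : t ≤ ν.real (Iic (qf ν t)) := (qf_le_iff ν ht _).1 le_rfl
  have h2 : ν.real (Iic (qf ν t)) ≤ nuM ν μ :=
    measureReal_mono (Iic_subset_Iio.2 hlt)
  linarith [h.1]

theorem lt_qf_of_nuP_lt (ν : Measure ℝ) [IsProbabilityMeasure ν] {μ t : ℝ}
    (ht : t ∈ Ioo (0:ℝ) 1) (h : nuP ν μ < t) : μ < qf ν t := by
  by_contra! hle
  exact absurd ((qf_le_iff ν ht μ).1 hle) (not_le.2 h)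

theorem map_qf (ν : Measure ℝ) [IsProbabilityMeasure ν] :
    Measure.map (qf ν) (volume.restrict (Icc (0:ℝ) 1)) = ν :=
  map_eq_of_le_iff_le_measure_Iic fun _ ht => qf_le_iff ν ht

theorem aemeasurable_qf (ν : Measure ℝ) [IsProbabilityMeasure ν] :
    AEMeasurable (qf ν) (volume.restrict (Icc (0:ℝ) 1)) :=
  aemeasurable_of_le_iff_le_measure_Iic fun _ ht => qf_le_iff ν ht

theorem integrable_qf {ν : Measure ℝ} [IsProbabilityMeasure ν] (hint : Integrable id ν) :
    Integrable (qf ν) := by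
  have h : IntegrableOn (qf ν) (Icc 0 1) := by
    rw [← map_qf ν] at hint
    exact hint.comp_aemeasurable (aemeasurable_qf ν)
  exact (integrableOn_iff_integrable_of_support_subset fun t ht => by
    by_contra h'
    exact ht (qf_eq_zero_of_notMem ν h')).1 h

theorem intervalIntegrable_qf_sub {ν : Measure ℝ} [IsProbabilityMeasure ν]
    (hint : Integrable id ν) (μ s t : ℝ) :
    IntervalIntegrable (fun t => qf ν t - μ) volume s t :=
  (integrable_qf hint).intervalIntegrable.sub intervalIntegrable_const

theorem continuous_Hfun {ν : Measure ℝ} [IsProbabilityMeasure ν]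
    (hint : Integrable id ν) (μ : ℝ) : Continuous (Hfun ν μ) :=
  intervalIntegral.continuous_primitive (intervalIntegrable_qf_sub hint μ) 0

theorem Hfun_zero (ν : Measure ℝ) (μ : ℝ) : Hfun ν μ 0 = 0 := intervalIntegral.integral_same

theorem Hfun_one {ν : Measure ℝ} [IsProbabilityMeasure ν] (hint : Integrable id ν) :
    Hfun ν (∫ x, x ∂ν) 1 = 0 := by
  have h : ∫ t in (0:ℝ)..1, qf ν t = ∫ x, x ∂ν := by
    rw [intervalIntegral.integral_of_le zero_le_one, ← integral_Icc_eq_integral_Ioc]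
    conv_rhs => rw [← map_qf ν]
    rw [integral_map (aemeasurable_qf ν) (by fun_prop)]
  rw [Hfun, intervalIntegral.integral_sub (integrable_qf hint).intervalIntegrable
    intervalIntegrable_const, h]
  simp

theorem Hfun_sub {ν : Measure ℝ} [IsProbabilityMeasure ν] (hint : Integrable id ν)
    (μ s t : ℝ) : Hfun ν μ t - Hfun ν μ s = ∫ x in s..t, (qf ν x - μ) :=
  intervalIntegral.integral_interval_sub_left (intervalIntegrable_qf_sub hint μ _ _)
    (intervalIntegrable_qf_sub hint μ _ _)

theorem strictAntiOn_Hfun {ν : Measure ℝ} [IsProbabilityMeasure ν] (hint : Integrable id ν)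
    (μ : ℝ) : StrictAntiOn (Hfun ν μ) (Icc 0 (nuM ν μ)) := by
  intro s hs t ht hst
  have h1 := nuM_mem_Icc ν μ
  have h : 0 < ∫ x in s..t, (μ - qf ν x) := by
    refine intervalIntegral.intervalIntegral_pos_of_pos_on ?_ (fun x hx => ?_) hst
    · exact intervalIntegrable_const.sub (integrable_qf hint).intervalIntegrable
    · have : x < nuM ν μ := hx.2.trans_le ht.2
      exact sub_pos.2 (qf_lt_of_lt_nuM ν ⟨hs.1.trans_lt hx.1, this.trans_le h1.2⟩ this)
  have h2 := Hfun_sub hint μ s t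
  have h3 : ∫ x in s..t, (μ - qf ν x) = -∫ x in s..t, (qf ν x - μ) := by
    rw [← intervalIntegral.integral_neg]; simp
  linarith

theorem strictMonoOn_Hfun {ν : Measure ℝ} [IsProbabilityMeasure ν] (hint : Integrable id ν)
    (μ : ℝ) : StrictMonoOn (Hfun ν μ) (Icc (nuP ν μ) 1) := by
  intro s hs t ht hst
  have h1 := nuP_mem_Icc ν μ
  have h : 0 < ∫ x in s..t, (qf ν x - μ) := by
    refine intervalIntegral.intervalIntegral_pos_of_pos_on
      (intervalIntegrable_qf_sub hint μ _ _) (fun x hx => ?_) hst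
    have : nuP ν μ < x := hs.1.trans_lt hx.1
    exact sub_pos.2 (lt_qf_of_nuP_lt ν ⟨h1.1.trans_lt this, hx.2.trans_le ht.2⟩ this)
  linarith [Hfun_sub hint μ s t]

theorem Hfun_eq_cval {ν : Measure ℝ} [IsProbabilityMeasure ν] (hint : Integrable id ν)
    {μ t : ℝ} (ht : t ∈ Icc (nuM ν μ) (nuP ν μ)) : Hfun ν μ t = cval ν μ := by
  rw [← sub_eq_zero, cval, Hfun_sub hint, intervalIntegral.integral_of_le ht.1,
    ← restrict_Ioo_eq_restrict_Ioc]
  rw [setIntegral_congr_fun (g := fun _ => (0:ℝ)) measurableSet_Ioo, integral_zero]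
  intro x hx
  have h1 := nuM_mem_Icc ν μ
  have h2 := nuP_mem_Icc ν μ
  exact sub_eq_zero.2 (qf_eq_of_mem_Ioc ν ⟨h1.1.trans_lt hx.1, hx.2.trans_le (ht.2.trans h2.2)⟩
    ⟨hx.1, hx.2.le.trans ht.2⟩)

theorem cval_le_zero {ν : Measure ℝ} [IsProbabilityMeasure ν] (hint : Integrable id ν)
    (μ : ℝ) : cval ν μ ≤ 0 := by
  have h := nuM_mem_Icc ν μ
  rw [← Hfun_zero ν μ]
  exact (strictAntiOn_Hfun hint μ).antitoneOn ⟨le_rfl, h.1⟩ ⟨h.1, le_rfl⟩ h.1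

theorem Hfun_nuP {ν : Measure ℝ} [IsProbabilityMeasure ν] (hint : Integrable id ν)
    (μ : ℝ) : Hfun ν μ (nuP ν μ) = cval ν μ :=
  Hfun_eq_cval hint ⟨nuM_le_nuP ν μ, le_rfl⟩

theorem Hfun_mem_of_mem_Ioo_nuM {ν : Measure ℝ} [IsProbabilityMeasure ν]
    (hint : Integrable id ν) {μ w : ℝ} (hw : w ∈ Ioo 0 (nuM ν μ)) :
    Hfun ν μ w ∈ Ioo (cval ν μ) 0 := by
  have h := (hw.1.trans hw.2).le
  refine ⟨strictAntiOn_Hfun hint μ ⟨hw.1.le, hw.2.le⟩ ⟨h, le_rfl⟩ hw.2, ?_⟩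
  rw [← Hfun_zero ν μ]
  exact strictAntiOn_Hfun hint μ ⟨le_rfl, h⟩ ⟨hw.1.le, hw.2.le⟩ hw.1

theorem Hfun_mem_of_mem_Ioo_nuP {ν : Measure ℝ} [IsProbabilityMeasure ν]
    (hint : Integrable id ν) {μ w : ℝ} (hμ : μ = ∫ x, x ∂ν) (hw : w ∈ Ioo (nuP ν μ) 1) :
    Hfun ν μ w ∈ Ioo (cval ν μ) 0 := by
  have h := (hw.1.trans hw.2).le
  have h1 : Hfun ν μ 1 = 0 := by rw [hμ]; exact Hfun_one hint
  rw [← Hfun_nuP hint, ← h1]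
  exact ⟨strictMonoOn_Hfun hint μ ⟨le_rfl, h⟩ ⟨hw.1.le, hw.2.le⟩ hw.1,
    strictMonoOn_Hfun hint μ ⟨hw.1.le, hw.2.le⟩ ⟨h, le_rfl⟩ hw.2⟩

theorem Afun_Hfun {ν : Measure ℝ} [IsProbabilityMeasure ν] (hint : Integrable id ν)
    {μ w : ℝ} (hw : w ∈ Ico 0 (nuM ν μ)) : Afun ν μ (Hfun ν μ w) = w := by
  have hanti := strictAntiOn_Hfun hint μ
  have h0 : 0 ≤ nuM ν μ := hw.1.trans hw.2.le
  have hne : cval ν μ < Hfun ν μ w := hanti ⟨hw.1, hw.2.le⟩ ⟨h0, le_rfl⟩ hw.2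
  rw [Afun, if_neg hne.ne']
  have : {t : ℝ | t ∈ Icc 0 (nuM ν μ) ∧ Hfun ν μ t ≤ Hfun ν μ w} = Icc w (nuM ν μ) := by
    ext t
    refine ⟨fun ⟨h1, h2⟩ => ⟨(hanti.le_iff_ge h1 ⟨hw.1, hw.2.le⟩).1 h2, h1.2⟩, fun h => ?_⟩
    have ht : t ∈ Icc 0 (nuM ν μ) := ⟨hw.1.trans h.1, h.2⟩
    exact ⟨ht, (hanti.le_iff_ge ht ⟨hw.1, hw.2.le⟩).2 h.1⟩
  rw [this, csInf_Icc hw.2.le]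

theorem Bfun_Hfun {ν : Measure ℝ} [IsProbabilityMeasure ν] (hint : Integrable id ν)
    {μ w : ℝ} (hw : w ∈ Ioc (nuP ν μ) 1) : Bfun ν μ (Hfun ν μ w) = w := by
  have hmono := strictMonoOn_Hfun hint μ
  have h0 : nuP ν μ ≤ 1 := hw.1.le.trans hw.2
  have hne : cval ν μ < Hfun ν μ w := by
    rw [← Hfun_nuP hint]; exact hmono ⟨le_rfl, h0⟩ ⟨hw.1.le, hw.2⟩ hw.1
  rw [Bfun, if_neg hne.ne']
  have : {t : ℝ | t ∈ Icc (nuP ν μ) 1 ∧ Hfun ν μ w ≤ Hfun ν μ t} = Icc w 1 := by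
    ext t
    refine ⟨fun ⟨h1, h2⟩ => ⟨(hmono.le_iff_le ⟨hw.1.le, hw.2⟩ h1).1 h2, h1.2⟩, fun h => ?_⟩
    have ht : t ∈ Icc (nuP ν μ) 1 := ⟨hw.1.le.trans h.1, h.2⟩
    exact ⟨ht, (hmono.le_iff_le ⟨hw.1.le, hw.2⟩ ht).2 h.1⟩
  rw [this, csInf_Icc hw.2]

theorem Afun_mem_Ico {ν : Measure ℝ} [IsProbabilityMeasure ν] (hint : Integrable id ν)
    {μ s : ℝ} (hs : s ∈ Ioc (cval ν μ) 0) :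
    Afun ν μ s ∈ Ico 0 (nuM ν μ) ∧ Hfun ν μ (Afun ν μ s) = s := by
  obtain ⟨w, hw, rfl⟩ := intermediate_value_Icc' (nuM_mem_Icc ν μ).1
    (continuous_Hfun hint μ).continuousOn
    (show s ∈ Icc (Hfun ν μ (nuM ν μ)) (Hfun ν μ 0) by
      rw [Hfun_zero]; exact ⟨hs.1.le, hs.2⟩)
  have hw' : w ∈ Ico 0 (nuM ν μ) := ⟨hw.1, hw.2.lt_of_ne (by rintro rfl; exact hs.1.ne rfl)⟩
  rw [Afun_Hfun hint hw']
  exact ⟨hw', rfl⟩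

theorem Bfun_mem_Ioc {ν : Measure ℝ} [IsProbabilityMeasure ν] (hint : Integrable id ν)
    {μ s : ℝ} (hμ : μ = ∫ x, x ∂ν) (hs : s ∈ Ioc (cval ν μ) 0) :
    Bfun ν μ s ∈ Ioc (nuP ν μ) 1 ∧ Hfun ν μ (Bfun ν μ s) = s := by
  have h1 : Hfun ν μ 1 = 0 := by rw [hμ]; exact Hfun_one hint
  obtain ⟨w, hw, rfl⟩ := intermediate_value_Icc (nuP_mem_Icc ν μ).2
    (continuous_Hfun hint μ).continuousOn
    (show s ∈ Icc (Hfun ν μ (nuP ν μ)) (Hfun ν μ 1) by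
      rw [h1, Hfun_nuP hint]; exact ⟨hs.1.le, hs.2⟩)
  have hw' : w ∈ Ioc (nuP ν μ) 1 := ⟨hw.1.lt_of_ne (by
    rintro rfl; exact hs.1.ne (Hfun_nuP hint μ).symm), hw.2⟩
  rw [Bfun_Hfun hint hw']
  exact ⟨hw', rfl⟩

theorem Afun_mem_Ioo {ν : Measure ℝ} [IsProbabilityMeasure ν] (hint : Integrable id ν)
    {μ s : ℝ} (hs : s ∈ Ioo (cval ν μ) 0) : Afun ν μ s ∈ Ioo 0 (nuM ν μ) := by
  obtain ⟨h1, h2⟩ := Afun_mem_Ico hint ⟨hs.1, hs.2.le⟩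
  refine ⟨h1.1.lt_of_ne fun h => ?_, h1.2⟩
  rw [← h, Hfun_zero] at h2
  exact hs.2.ne' h2

theorem Bfun_mem_Ioo {ν : Measure ℝ} [IsProbabilityMeasure ν] (hint : Integrable id ν)
    {μ s : ℝ} (hμ : μ = ∫ x, x ∂ν) (hs : s ∈ Ioo (cval ν μ) 0) :
    Bfun ν μ s ∈ Ioo (nuP ν μ) 1 := by
  obtain ⟨h1, h2⟩ := Bfun_mem_Ioc hint hμ ⟨hs.1, hs.2.le⟩
  refine ⟨h1.1, h1.2.lt_of_ne fun h => ?_⟩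
  rw [h, show Hfun ν μ 1 = 0 by rw [hμ]; exact Hfun_one hint] at h2
  exact hs.2.ne' h2

theorem map_Hfun_Iic_of_le_iff {ν : Measure ℝ} [IsProbabilityMeasure ν]
    (hint : Integrable id ν) {μ s α β : ℝ} (hα : 0 ≤ α) (hβ : β ≤ 1)
    (h : ∀ w ∈ Ioo (0:ℝ) 1, Hfun ν μ w ≤ s ↔ w ∈ Icc α β) :
    Measure.map (Hfun ν μ) (volume.restrict (Icc (0:ℝ) 1)) (Iic s) =
      ENNReal.ofReal (β - α) := by
  have hae : Hfun ν μ ⁻¹' Iic s =ᵐ[volume.restrict (Icc (0:ℝ) 1)] Icc α β := by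
    filter_upwards [ae_restrict_Icc_mem_Ioo] with w hw
    exact propext (h w hw)
  rw [Measure.map_apply (continuous_Hfun hint μ).measurable measurableSet_Iic,
    measure_congr hae, Measure.restrict_apply measurableSet_Icc, Icc_inter_Icc,
    sup_of_le_left hα, inf_of_le_left hβ, Real.volume_Icc]

/-- The law of `H(W)`, for `W` uniform on `[0, 1]`, has distribution function `K`. -/
theorem map_Hfun_Iic {ν : Measure ℝ} [IsProbabilityMeasure ν] (hint : Integrable id ν)
    {μ : ℝ} (hμ : μ = ∫ x, x ∂ν) (s : ℝ) :
    (Measure.map (Hfun ν μ) (volume.restrict (Icc (0:ℝ) 1)) (Iic s)).toReal = Kfun ν μ s := by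
  have hM := nuM_mem_Icc ν μ
  have hP := nuP_mem_Icc ν μ
  have hMP := nuM_le_nuP ν μ
  have hc := cval_le_zero hint μ
  have hcases : ∀ w ∈ Ioo (0:ℝ) 1,
      (w ∈ Ioo 0 (nuM ν μ) ∧ Hfun ν μ w ∈ Ioo (cval ν μ) 0) ∨
      (w ∈ Icc (nuM ν μ) (nuP ν μ) ∧ Hfun ν μ w = cval ν μ) ∨
      (w ∈ Ioo (nuP ν μ) 1 ∧ Hfun ν μ w ∈ Ioo (cval ν μ) 0) := by
    intro w hw
    rcases lt_or_ge w (nuM ν μ) with h | h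
    · exact Or.inl ⟨⟨hw.1, h⟩, Hfun_mem_of_mem_Ioo_nuM hint ⟨hw.1, h⟩⟩
    rcases le_or_gt w (nuP ν μ) with h' | h'
    · exact Or.inr (Or.inl ⟨⟨h, h'⟩, Hfun_eq_cval hint ⟨h, h'⟩⟩)
    · exact Or.inr (Or.inr ⟨⟨h', hw.2⟩, Hfun_mem_of_mem_Ioo_nuP hint hμ ⟨h', hw.2⟩⟩)
  rw [Kfun]
  split_ifs with h1 h2 h3
  · rw [map_Hfun_Iic_of_le_iff hint le_rfl le_rfl]
    · simp
    · intro w hw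
      refine iff_of_true ?_ ⟨hw.1.le, hw.2.le⟩
      rcases hcases w hw with ⟨_, h⟩ | ⟨_, h⟩ | ⟨_, h⟩
      · exact h.2.le.trans h1.le
      · linarith
      · exact h.2.le.trans h1.le
  · rw [map_Hfun_Iic_of_le_iff hint zero_le_one zero_le_one]
    · simp [ENNReal.ofReal_of_nonpos]
    · intro w hw
      refine iff_of_false (not_le.2 (h2.trans_le ?_)) fun h => absurd (h.1.trans h.2) (by simp)
      rcases hcases w hw with ⟨_, h⟩ | ⟨_, h⟩ | ⟨_, h⟩
      exacts [h.1.le, h.ge, h.1.le]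
  · rw [map_Hfun_Iic_of_le_iff hint hM.1 hP.2, ENNReal.toReal_ofReal (by linarith)]
    intro w hw
    rcases hcases w hw with ⟨h, h'⟩ | ⟨h, h'⟩ | ⟨h, h'⟩
    · exact iff_of_false (not_le.2 (h3 ▸ h'.1)) fun h4 => absurd h.2 (not_lt.2 h4.1)
    · exact iff_of_true (h'.trans h3.symm).le h
    · exact iff_of_false (not_le.2 (h3 ▸ h'.1)) fun h4 => absurd h.1 (not_lt.2 h4.2)
  · have hs : s ∈ Ioc (cval ν μ) 0 :=
      ⟨lt_of_le_of_ne (not_lt.1 h2) (Ne.symm h3), not_lt.1 h1⟩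
    obtain ⟨hA, hA'⟩ := Afun_mem_Ico hint hs
    obtain ⟨hB, hB'⟩ := Bfun_mem_Ioc hint hμ hs
    rw [map_Hfun_Iic_of_le_iff hint hA.1 hB.2,
      ENNReal.toReal_ofReal (by linarith [hA.2, hB.1])]
    intro w hw
    rcases hcases w hw with ⟨h, -⟩ | ⟨h, h'⟩ | ⟨h, -⟩
    · conv_lhs => rw [← hA']
      rw [(strictAntiOn_Hfun hint μ).le_iff_ge ⟨h.1.le, h.2.le⟩ ⟨hA.1, hA.2.le⟩]
      exact ⟨fun h4 => ⟨h4, by linarith [h.2, hB.1]⟩, fun h4 => h4.1⟩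
    · exact iff_of_true (h'.le.trans hs.1.le) ⟨hA.2.le.trans h.1, h.2.trans hB.1.le⟩
    · conv_lhs => rw [← hB']
      rw [(strictMonoOn_Hfun hint μ).le_iff_le ⟨h.1.le, h.2.le⟩ ⟨hB.1.le, hB.2⟩]
      exact ⟨fun h4 => ⟨by linarith [h.1, hA.2], h4⟩, fun h4 => h4.2⟩

/-- The lower of the two values taken, given `Y = s`, by a variable with law `ν`. -/
noncomputable def lowerValue (ν : Measure ℝ) (μ s : ℝ) : ℝ :=
  if cval ν μ < s ∧ s < 0 then qf ν (Afun ν μ s) else μ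

/-- The upper of the two values taken, given `Y = s`, by a variable with law `ν`. -/
noncomputable def upperValue (ν : Measure ℝ) (μ s : ℝ) : ℝ :=
  if cval ν μ < s ∧ s < 0 then qf ν (Bfun ν μ s) else μ

theorem qf_Afun_lt {ν : Measure ℝ} [IsProbabilityMeasure ν] (hint : Integrable id ν)
    {μ s : ℝ} (hs : s ∈ Ioo (cval ν μ) 0) : qf ν (Afun ν μ s) < μ := by
  have h := Afun_mem_Ioo hint hs
  exact qf_lt_of_lt_nuM ν ⟨h.1, h.2.trans_le (nuM_mem_Icc ν μ).2⟩ h.2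

theorem lt_qf_Bfun {ν : Measure ℝ} [IsProbabilityMeasure ν] (hint : Integrable id ν)
    {μ s : ℝ} (hμ : μ = ∫ x, x ∂ν) (hs : s ∈ Ioo (cval ν μ) 0) :
    μ < qf ν (Bfun ν μ s) := by
  have h := Bfun_mem_Ioo hint hμ hs
  exact lt_qf_of_nuP_lt ν ⟨(nuP_mem_Icc ν μ).1.trans_lt h.1, h.2⟩ h.1

theorem lowerValue_le {ν : Measure ℝ} [IsProbabilityMeasure ν] (hint : Integrable id ν)
    (μ s : ℝ) : lowerValue ν μ s ≤ μ := by
  rw [lowerValue]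
  split_ifs with hs
  exacts [(qf_Afun_lt hint hs).le, le_rfl]

theorem le_upperValue {ν : Measure ℝ} [IsProbabilityMeasure ν] (hint : Integrable id ν)
    {μ : ℝ} (hμ : μ = ∫ x, x ∂ν) (s : ℝ) : μ ≤ upperValue ν μ s := by
  rw [upperValue]
  split_ifs with hs
  exacts [(lt_qf_Bfun hint hμ hs).le, le_rfl]

theorem antitoneOn_qf_Afun {ν : Measure ℝ} [IsProbabilityMeasure ν] (hint : Integrable id ν)
    (μ : ℝ) : AntitoneOn (fun s => qf ν (Afun ν μ s)) (Ioo (cval ν μ) 0) := by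
  intro s hs t ht hst
  have h1 := (nuM_mem_Icc ν μ).2
  obtain ⟨hA, hA'⟩ := Afun_mem_Ico hint ⟨hs.1, hs.2.le⟩
  obtain ⟨hB, hB'⟩ := Afun_mem_Ico hint ⟨ht.1, ht.2.le⟩
  have h2 := Afun_mem_Ioo hint hs
  have h3 := Afun_mem_Ioo hint ht
  refine monotoneOn_of_le_iff_le_measure_Iic (fun _ h => qf_le_iff ν h)
    ⟨h3.1, h3.2.trans_le h1⟩ ⟨h2.1, h2.2.trans_le h1⟩ ?_
  rw [← (strictAntiOn_Hfun hint μ).le_iff_ge ⟨hA.1, hA.2.le⟩ ⟨hB.1, hB.2.le⟩, hA', hB']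
  exact hst

theorem monotoneOn_qf_Bfun {ν : Measure ℝ} [IsProbabilityMeasure ν] (hint : Integrable id ν)
    {μ : ℝ} (hμ : μ = ∫ x, x ∂ν) :
    MonotoneOn (fun s => qf ν (Bfun ν μ s)) (Ioo (cval ν μ) 0) := by
  intro s hs t ht hst
  have h1 := (nuP_mem_Icc ν μ).1
  obtain ⟨hA, hA'⟩ := Bfun_mem_Ioc hint hμ ⟨hs.1, hs.2.le⟩
  obtain ⟨hB, hB'⟩ := Bfun_mem_Ioc hint hμ ⟨ht.1, ht.2.le⟩
  have h2 := Bfun_mem_Ioo hint hμ hs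
  have h3 := Bfun_mem_Ioo hint hμ ht
  refine monotoneOn_of_le_iff_le_measure_Iic (fun _ h => qf_le_iff ν h)
    ⟨h1.trans_lt h2.1, h2.2⟩ ⟨h1.trans_lt h3.1, h3.2⟩ ?_
  rw [← (strictMonoOn_Hfun hint μ).le_iff_le ⟨hA.1.le, hA.2⟩ ⟨hB.1.le, hB.2⟩, hA', hB']
  exact hst

theorem measurable_lowerValue {ν : Measure ℝ} [IsProbabilityMeasure ν]
    (hint : Integrable id ν) (μ : ℝ) : Measurable (lowerValue ν μ) := by
  refine measurable_of_Iic fun y => ?_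
  rcases le_or_gt μ y with hy | hy
  · convert MeasurableSet.univ
    exact eq_univ_of_forall fun s => (lowerValue_le hint μ s).trans hy
  refine OrdConnected.measurableSet ⟨fun s hs t ht r hr => ?_⟩
  have key : ∀ x ∈ lowerValue ν μ ⁻¹' Iic y,
      x ∈ Ioo (cval ν μ) 0 ∧ qf ν (Afun ν μ x) ≤ y := by
    intro x hx
    rw [mem_preimage, mem_Iic, lowerValue] at hx
    split_ifs at hx with h
    exacts [⟨h, hx⟩, absurd hx (not_le.2 hy)]
  obtain ⟨hs1, hs2⟩ := key s hs
  have hr1 : r ∈ Ioo (cval ν μ) 0 := ⟨hs1.1.trans_le hr.1, hr.2.trans_lt (key t ht).1.2⟩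
  rw [mem_preimage, mem_Iic, lowerValue, if_pos (show cval ν μ < r ∧ r < 0 from hr1)]
  exact (antitoneOn_qf_Afun hint μ hs1 hr1 hr.1).trans hs2

theorem measurable_upperValue {ν : Measure ℝ} [IsProbabilityMeasure ν]
    (hint : Integrable id ν) {μ : ℝ} (hμ : μ = ∫ x, x ∂ν) : Measurable (upperValue ν μ) := by
  refine measurable_of_Ici fun y => ?_
  rcases le_or_gt y μ with hy | hy
  · convert MeasurableSet.univ
    exact eq_univ_of_forall fun s => hy.trans (le_upperValue hint hμ s)
  refine OrdConnected.measurableSet ⟨fun s hs t ht r hr => ?_⟩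
  have key : ∀ x ∈ upperValue ν μ ⁻¹' Ici y,
      x ∈ Ioo (cval ν μ) 0 ∧ y ≤ qf ν (Bfun ν μ x) := by
    intro x hx
    rw [mem_preimage, mem_Ici, upperValue] at hx
    split_ifs at hx with h
    exacts [⟨h, hx⟩, absurd hx (not_le.2 hy)]
  obtain ⟨hs1, hs2⟩ := key s hs
  have hr1 : r ∈ Ioo (cval ν μ) 0 := ⟨hs1.1.trans_le hr.1, hr.2.trans_lt (key t ht).1.2⟩
  rw [mem_preimage, mem_Ici, upperValue, if_pos (show cval ν μ < r ∧ r < 0 from hr1)]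
  exact hs2.trans (monotoneOn_qf_Bfun hint hμ hs1 hr1 hr.1)

theorem setLIntegral_Ioo_ofReal_eq {f : ℝ → ℝ} {α β : ℝ} (hαβ : α ≤ β)
    (hf : IntervalIntegrable f volume α β) (hpos : ∀ x ∈ Ioo α β, 0 ≤ f x) :
    ∫⁻ x in Ioo α β, ENNReal.ofReal (f x) = ENNReal.ofReal (∫ x in α..β, f x) := by
  rw [intervalIntegral.integral_of_le hαβ, ← restrict_Ioo_eq_restrict_Ioc,
    ofReal_integral_eq_lintegral_ofReal]
  · exact ((intervalIntegrable_iff_integrableOn_Ioo_of_le hαβ).1 hf)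
  · filter_upwards [ae_restrict_mem measurableSet_Ioo] with x hx using hpos x hx

theorem map_Hfun_withDensity_eq {ν : Measure ℝ} [IsProbabilityMeasure ν]
    (hint : Integrable id ν) {μ : ℝ} (hμ : μ = ∫ x, x ∂ν) :
    Measure.map (Hfun ν μ) ((volume.restrict (Ioo 0 (nuM ν μ))).withDensity
      fun w => ENNReal.ofReal (μ - qf ν w)) =
    Measure.map (Hfun ν μ) ((volume.restrict (Ioo (nuP ν μ) 1)).withDensity
      fun w => ENNReal.ofReal (qf ν w - μ)) := by
  have hM := nuM_mem_Icc ν μ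
  have hP := nuP_mem_Icc ν μ
  have hHm := (continuous_Hfun hint μ).measurable
  have hfin : IsFiniteMeasure ((volume.restrict (Ioo 0 (nuM ν μ))).withDensity
      fun w => ENNReal.ofReal (μ - qf ν w)) :=
    isFiniteMeasure_withDensity_ofReal
      (((integrable_const μ).sub (integrable_qf hint).restrict).2)
  refine Measure.ext_of_Iic _ _ fun s => ?_
  rw [Measure.map_apply hHm measurableSet_Iic, Measure.map_apply hHm measurableSet_Iic,
    withDensity_apply _ (hHm measurableSet_Iic), withDensity_apply _ (hHm measurableSet_Iic),
    Measure.restrict_restrict (hHm measurableSet_Iic),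
    Measure.restrict_restrict (hHm measurableSet_Iic)]
  by_cases hs : cval ν μ < min s 0
  · set s' := min s 0 with hs'
    have hmem : s' ∈ Ioc (cval ν μ) 0 := ⟨hs, min_le_right _ _⟩
    obtain ⟨hA, hA'⟩ := Afun_mem_Ico hint hmem
    obtain ⟨hB, hB'⟩ := Bfun_mem_Ioc hint hμ hmem
    have hiff : ∀ {x}, x ∈ Ioo (cval ν μ) 0 → (x ≤ s ↔ x ≤ s') := fun hx => by
      rw [hs', le_min_iff, and_iff_left hx.2.le]
    have e1 : (Hfun ν μ ⁻¹' Iic s ∩ Ioo 0 (nuM ν μ) : Set ℝ) =ᵐ[volume]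
        Ioo (Afun ν μ s') (nuM ν μ) := by
      filter_upwards [(countable_singleton (Afun ν μ s')).ae_notMem volume] with w hw
      refine propext (show (Hfun ν μ w ≤ s ∧ w ∈ Ioo _ _) ↔ w ∈ Ioo _ _ from ?_)
      have key : ∀ h : w ∈ Ioo 0 (nuM ν μ), Hfun ν μ w ≤ s ↔ Afun ν μ s' ≤ w := fun h => by
        rw [hiff (Hfun_mem_of_mem_Ioo_nuM hint h),
          ← (strictAntiOn_Hfun hint μ).le_iff_ge ⟨h.1.le, h.2.le⟩ ⟨hA.1, hA.2.le⟩, hA']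
      refine ⟨fun ⟨h1, h2⟩ => ⟨((key h2).1 h1).lt_of_ne fun h => hw h.symm, h2.2⟩, fun h => ?_⟩
      have h2 : w ∈ Ioo 0 (nuM ν μ) := ⟨hA.1.trans_lt h.1, h.2⟩
      exact ⟨(key h2).2 h.1.le, h2⟩
    have e2 : (Hfun ν μ ⁻¹' Iic s ∩ Ioo (nuP ν μ) 1 : Set ℝ) =ᵐ[volume]
        Ioo (nuP ν μ) (Bfun ν μ s') := by
      filter_upwards [(countable_singleton (Bfun ν μ s')).ae_notMem volume] with w hw
      refine propext (show (Hfun ν μ w ≤ s ∧ w ∈ Ioo _ _) ↔ w ∈ Ioo _ _ from ?_)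
      have key : ∀ h : w ∈ Ioo (nuP ν μ) 1, Hfun ν μ w ≤ s ↔ w ≤ Bfun ν μ s' := fun h => by
        rw [hiff (Hfun_mem_of_mem_Ioo_nuP hint hμ h),
          ← (strictMonoOn_Hfun hint μ).le_iff_le ⟨h.1.le, h.2.le⟩ ⟨hB.1.le, hB.2⟩, hB']
      refine ⟨fun ⟨h1, h2⟩ => ⟨h2.1, ((key h2).1 h1).lt_of_ne hw⟩, fun h => ?_⟩
      have h2 : w ∈ Ioo (nuP ν μ) 1 := ⟨h.1, h.2.trans_le hB.2⟩
      exact ⟨(key h2).2 h.2.le, h2⟩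
    rw [Measure.restrict_congr_set e1, Measure.restrict_congr_set e2,
      setLIntegral_Ioo_ofReal_eq hA.2.le, setLIntegral_Ioo_ofReal_eq hB.1.le
        (intervalIntegrable_qf_sub hint μ _ _), ← Hfun_sub hint, hB', Hfun_nuP hint]
    · have h3 : ∫ x in Afun ν μ s'..nuM ν μ, (μ - qf ν x) =
          -∫ x in Afun ν μ s'..nuM ν μ, (qf ν x - μ) := by
        rw [← intervalIntegral.integral_neg]; simp
      rw [h3, ← Hfun_sub hint, hA', neg_sub]
      rfl
    · intro x hx
      exact sub_nonneg.2 (lt_qf_of_nuP_lt ν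
        ⟨hP.1.trans_lt hx.1, hx.2.trans_le hB.2⟩ hx.1).le
    · exact intervalIntegrable_const.sub (integrable_qf hint).intervalIntegrable
    · intro x hx
      exact sub_nonneg.2 (qf_lt_of_lt_nuM ν
        ⟨hA.1.trans_lt hx.1, hx.2.trans_le hM.2⟩ hx.2).le
  · have e1 : (Hfun ν μ ⁻¹' Iic s ∩ Ioo 0 (nuM ν μ) : Set ℝ) = ∅ := by
      refine eq_empty_of_forall_notMem fun w ⟨h1, h2⟩ => hs ?_
      have h3 := Hfun_mem_of_mem_Ioo_nuM hint h2
      exact lt_min (h3.1.trans_le h1) (h3.1.trans h3.2)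
    have e2 : (Hfun ν μ ⁻¹' Iic s ∩ Ioo (nuP ν μ) 1 : Set ℝ) = ∅ := by
      refine eq_empty_of_forall_notMem fun w ⟨h1, h2⟩ => hs ?_
      have h3 := Hfun_mem_of_mem_Ioo_nuP hint hμ h2
      exact lt_min (h3.1.trans_le h1) (h3.1.trans h3.2)
    rw [e1, e2]
    simp

theorem lintegral_Icc_eq_add_add (f : ℝ → ENNReal) {p q : ℝ} (hp : 0 ≤ p) (hpq : p ≤ q)
    (hq : q ≤ 1) :
    ∫⁻ w in Icc 0 1, f w =
      (∫⁻ w in Ioo 0 p, f w) + (∫⁻ w in Icc p q, f w) + ∫⁻ w in Ioo q 1, f w := by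
  rw [restrict_Ioo_eq_restrict_Ico (a := 0), restrict_Ioo_eq_restrict_Ioc (b := (1:ℝ)),
    ← lintegral_union measurableSet_Icc, Ico_union_Icc_eq_Icc hp hpq,
    ← lintegral_union measurableSet_Ioc, Icc_union_Ioc_eq_Icc (hp.trans hpq) hq]
  · exact disjoint_left.2 fun x h1 h2 => absurd h1.2 (not_le.2 h2.1)
  · exact disjoint_left.2 fun x h1 h2 => absurd h1.2 (not_lt.2 h2.1)

theorem lowerValue_Hfun {ν : Measure ℝ} [IsProbabilityMeasure ν] (hint : Integrable id ν)
    {μ w : ℝ} (hw : w ∈ Ioo 0 (nuM ν μ)) : lowerValue ν μ (Hfun ν μ w) = qf ν w := by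
  rw [lowerValue, if_pos (show _ ∧ _ from Hfun_mem_of_mem_Ioo_nuM hint hw),
    Afun_Hfun hint ⟨hw.1.le, hw.2⟩]

theorem upperValue_Hfun {ν : Measure ℝ} [IsProbabilityMeasure ν] (hint : Integrable id ν)
    {μ w : ℝ} (hμ : μ = ∫ x, x ∂ν) (hw : w ∈ Ioo (nuP ν μ) 1) :
    upperValue ν μ (Hfun ν μ w) = qf ν w := by
  rw [upperValue, if_pos (show _ ∧ _ from Hfun_mem_of_mem_Ioo_nuP hint hμ hw),
    Bfun_Hfun hint ⟨hw.1, hw.2.le⟩]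

theorem lintegral_weight_comp_Hfun {ν : Measure ℝ} [IsProbabilityMeasure ν]
    (hint : Integrable id ν) {μ : ℝ} (hμ : μ = ∫ x, x ∂ν) {φ : ℝ → ENNReal}
    (hφ : Measurable φ) :
    ∫⁻ w in Ioo 0 (nuM ν μ), ENNReal.ofReal ((μ - lowerValue ν μ (Hfun ν μ w)) /
        (upperValue ν μ (Hfun ν μ w) - lowerValue ν μ (Hfun ν μ w))) * φ (Hfun ν μ w) =
    ∫⁻ w in Ioo (nuP ν μ) 1, ENNReal.ofReal (1 - (μ - lowerValue ν μ (Hfun ν μ w)) /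
        (upperValue ν μ (Hfun ν μ w) - lowerValue ν μ (Hfun ν μ w))) * φ (Hfun ν μ w) := by
  have hHm := (continuous_Hfun hint μ).measurable
  have ha := measurable_lowerValue hint μ
  have hb := measurable_upperValue hint hμ
  set ψ : ℝ → ENNReal := fun s =>
    ENNReal.ofReal (upperValue ν μ s - lowerValue ν μ s)⁻¹ * φ s with hψ
  have hψm : Measurable ψ := by fun_prop
  have hqm := (integrable_qf hint).aemeasurable
  have hgap : ∀ s, 0 ≤ (upperValue ν μ s - lowerValue ν μ s)⁻¹ := fun s =>
    inv_nonneg.2 (by linarith [lowerValue_le hint μ s, le_upperValue hint hμ s])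
  have key := congrArg (fun m => ∫⁻ s, ψ s ∂m) (map_Hfun_withDensity_eq hint hμ)
  beta_reduce at key
  rw [lintegral_map hψm hHm, lintegral_map hψm hHm,
    lintegral_withDensity_eq_lintegral_mul₀ (by fun_prop) (by fun_prop),
    lintegral_withDensity_eq_lintegral_mul₀ (by fun_prop) (by fun_prop)] at key
  refine Eq.trans ?_ (key.trans ?_)
  · refine setLIntegral_congr_fun measurableSet_Ioo fun w hw => ?_
    have h := lowerValue_le hint μ (Hfun ν μ w)
    simp only [hψ, Pi.mul_apply]
    rw [← mul_assoc, ← lowerValue_Hfun hint hw, ← ENNReal.ofReal_mul (by linarith),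
      div_eq_mul_inv]
  · refine setLIntegral_congr_fun measurableSet_Ioo fun w hw => ?_
    have h := le_upperValue hint hμ (Hfun ν μ w)
    have h1 : μ < upperValue ν μ (Hfun ν μ w) := by
      rw [upperValue_Hfun hint hμ hw]
      exact lt_qf_of_nuP_lt ν ⟨(nuP_mem_Icc ν μ).1.trans_lt hw.1, hw.2⟩ hw.1
    have h2 := lowerValue_le hint μ (Hfun ν μ w)
    simp only [hψ, Pi.mul_apply]
    rw [← mul_assoc, ← upperValue_Hfun hint hμ hw, ← ENNReal.ofReal_mul (by linarith)]
    congr 2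
    rw [eq_sub_iff_add_eq, ← div_eq_mul_inv, ← add_div]
    rw [div_eq_one_iff_eq (by linarith)]
    ring

/-- Given `Y = H(W)`, choosing the two values with mean `μ` reproduces the law `ν`. -/
theorem lintegral_two_point_mixture {ν : Measure ℝ} [IsProbabilityMeasure ν]
    (hint : Integrable id ν) {μ : ℝ} (hμ : μ = ∫ x, x ∂ν) {S : Set ℝ} (hS : MeasurableSet S) :
    ∫⁻ s, (ENNReal.ofReal ((μ - lowerValue ν μ s) / (upperValue ν μ s - lowerValue ν μ s)) *
          S.indicator 1 (upperValue ν μ s) +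
        ENNReal.ofReal (1 - (μ - lowerValue ν μ s) / (upperValue ν μ s - lowerValue ν μ s)) *
          S.indicator 1 (lowerValue ν μ s))
      ∂(Measure.map (Hfun ν μ) (volume.restrict (Icc (0:ℝ) 1))) = ν S := by
  have hM := nuM_mem_Icc ν μ
  have hP := nuP_mem_Icc ν μ
  have hHm := (continuous_Hfun hint μ).measurable
  have ha := measurable_lowerValue hint μ
  have hb := measurable_upperValue hint hμ
  have hI : Measurable (S.indicator (1 : ℝ → ENNReal)) := measurable_one.indicator hS
  have hφa : Measurable fun s => S.indicator (1 : ℝ → ENNReal) (lowerValue ν μ s) :=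
    hI.comp ha
  have hφb : Measurable fun s => S.indicator (1 : ℝ → ENNReal) (upperValue ν μ s) :=
    hI.comp hb
  have hu0 : ∀ s, 0 ≤ (μ - lowerValue ν μ s) / (upperValue ν μ s - lowerValue ν μ s) :=
    fun s => div_nonneg (by linarith [lowerValue_le hint μ s])
      (by linarith [lowerValue_le hint μ s, le_upperValue hint hμ s])
  have hu1 : ∀ s, (μ - lowerValue ν μ s) / (upperValue ν μ s - lowerValue ν μ s) ≤ 1 :=
    fun s => div_le_one_of_le₀ (by linarith [le_upperValue hint hμ s])
      (by linarith [lowerValue_le hint μ s, le_upperValue hint hμ s])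
  have hweight : ∀ s (x : ENNReal),
      ENNReal.ofReal ((μ - lowerValue ν μ s) / (upperValue ν μ s - lowerValue ν μ s)) * x +
      ENNReal.ofReal (1 - (μ - lowerValue ν μ s) / (upperValue ν μ s - lowerValue ν μ s)) * x
        = x := by
    intro s x
    rw [← add_mul, ← ENNReal.ofReal_add (hu0 s) (sub_nonneg.2 (hu1 s))]
    simp
  have hνS : ν S = ∫⁻ w in Icc 0 1, S.indicator 1 (qf ν w) := by
    rw [← lintegral_map' hI.aemeasurable (aemeasurable_qf ν), map_qf ν,
      lintegral_indicator_one hS]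
  rw [lintegral_map (by fun_prop) hHm, hνS,
    lintegral_Icc_eq_add_add _ hM.1 (nuM_le_nuP ν μ) hP.2,
    lintegral_Icc_eq_add_add _ hM.1 (nuM_le_nuP ν μ) hP.2,
    lintegral_add_left (μ := volume.restrict (Ioo 0 _)) (by fun_prop),
    lintegral_add_left (μ := volume.restrict (Ioo _ 1)) (by fun_prop),
    lintegral_weight_comp_Hfun hint hμ hφb, ← lintegral_weight_comp_Hfun hint hμ hφa]
  have hmid : ∀ X Y Z U V : ENNReal, X + Y + V + (Z + U) = (U + Y) + V + (Z + X) := by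
    intro X Y Z U V; ring
  rw [hmid, ← lintegral_add_left (by fun_prop), ← lintegral_add_left (by fun_prop)]
  congr 1
  · congr 1
    · refine setLIntegral_congr_fun measurableSet_Ioo fun w hw => ?_
      rw [← lowerValue_Hfun hint hw]
      exact hweight _ _
    · refine setLIntegral_congr_fun_ae measurableSet_Icc ?_
      filter_upwards [(countable_singleton (nuM ν μ)).ae_notMem volume,
        (countable_singleton (1:ℝ)).ae_notMem volume] with w hw1 hw2 hw
      have h1 : nuM ν μ < w := hw.1.lt_of_ne fun h => hw1 h.symm
      have hq : qf ν w = μ := qf_eq_of_mem_Ioc ν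
        ⟨hM.1.trans_lt h1, (hw.2.trans hP.2).lt_of_ne hw2⟩ ⟨h1, hw.2⟩
      have ha' : lowerValue ν μ (cval ν μ) = μ := by simp [lowerValue]
      have hb' : upperValue ν μ (cval ν μ) = μ := by simp [upperValue]
      simp [Hfun_eq_cval hint hw, ha', hb', hq]
  · refine setLIntegral_congr_fun measurableSet_Ioo fun w hw => ?_
    rw [← upperValue_Hfun hint hμ hw]
    exact hweight _ _

theorem Kinv_le_iff {ν : Measure ℝ} [IsProbabilityMeasure ν] (hint : Integrable id ν) {μ : ℝ}
    (hμ : μ = ∫ x, x ∂ν) {t : ℝ} (ht : t ∈ Ioo (0:ℝ) 1) (s : ℝ) :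
    Kinv ν μ t ≤ s ↔
      t ≤ (Measure.map (Hfun ν μ) (volume.restrict (Icc (0:ℝ) 1)) (Iic s)).toReal := by
  have hprob : IsProbabilityMeasure (volume.restrict (Icc (0:ℝ) 1)) := ⟨by simp⟩
  have := Measure.isProbabilityMeasure_map (μ := volume.restrict (Icc (0:ℝ) 1))
    (continuous_Hfun hint μ).measurable.aemeasurable
  rw [← sInf_le_iff_le_measure_Iic _ ht]
  simp only [map_Hfun_Iic hint hμ, Kinv]

theorem upperValue_sub_lowerValue_ae_eq {ν : Measure ℝ} [IsProbabilityMeasure ν]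
    (hint : Integrable id ν) {μ : ℝ} (hμ : μ = ∫ x, x ∂ν) :
    (fun s => upperValue ν μ s - lowerValue ν μ s)
      =ᵐ[Measure.map (Hfun ν μ) (volume.restrict (Icc (0:ℝ) 1))]
      fun s => qf ν (Bfun ν μ s) - qf ν (Afun ν μ s) := by
  have hmem : ∀ᵐ s ∂(Measure.map (Hfun ν μ) (volume.restrict (Icc (0:ℝ) 1))),
      s ∈ insert (cval ν μ) (Ioo (cval ν μ) 0) := by
    refine (ae_map_iff (continuous_Hfun hint μ).measurable.aemeasurable
      (measurableSet_Ioo.insert _)).2 ?_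
    filter_upwards [ae_restrict_Icc_mem_Ioo] with w hw
    rcases lt_or_ge w (nuM ν μ) with h | h
    · exact Or.inr (Hfun_mem_of_mem_Ioo_nuM hint ⟨hw.1, h⟩)
    rcases le_or_gt w (nuP ν μ) with h' | h'
    · exact Or.inl (Hfun_eq_cval hint ⟨h, h'⟩)
    · exact Or.inr (Hfun_mem_of_mem_Ioo_nuP hint hμ ⟨h', hw.2⟩)
  filter_upwards [hmem] with s hs
  rcases hs with rfl | hs
  · simp [upperValue, lowerValue, Afun, Bfun]
  · rw [upperValue, lowerValue, if_pos (show _ ∧ _ from hs), if_pos (show _ ∧ _ from hs)]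

theorem residualDist_eq_map {ν : Measure ℝ} [IsProbabilityMeasure ν]
    (hint : Integrable id ν) {μ : ℝ} (hμ : μ = ∫ x, x ∂ν) :
    residualDist ν μ = Measure.map (fun s => upperValue ν μ s - lowerValue ν μ s)
      (Measure.map (Hfun ν μ) (volume.restrict (Icc (0:ℝ) 1))) := by
  have hprob : IsProbabilityMeasure (volume.restrict (Icc (0:ℝ) 1)) := ⟨by simp⟩
  have := Measure.isProbabilityMeasure_map (μ := volume.restrict (Icc (0:ℝ) 1))
    (continuous_Hfun hint μ).measurable.aemeasurable
  have hK : AEMeasurable (Kinv ν μ) (volume.restrict (Icc (0:ℝ) 1)) :=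
    aemeasurable_of_le_iff_le_measure_Iic fun t ht s => Kinv_le_iff hint hμ ht s
  have hmap : Measure.map (Kinv ν μ) (volume.restrict (Icc (0:ℝ) 1)) =
      Measure.map (Hfun ν μ) (volume.restrict (Icc (0:ℝ) 1)) :=
    map_eq_of_le_iff_le_measure_Iic fun t ht s => Kinv_le_iff hint hμ ht s
  have hae := upperValue_sub_lowerValue_ae_eq hint hμ
  have hm : AEMeasurable (fun s => qf ν (Bfun ν μ s) - qf ν (Afun ν μ s))
      (Measure.map (Kinv ν μ) (volume.restrict (Icc (0:ℝ) 1))) := by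
    rw [hmap]
    exact ((measurable_upperValue hint hμ).sub
      (measurable_lowerValue hint μ)).aemeasurable.congr hae
  rw [Measure.map_congr hae, ← hmap, AEMeasurable.map_map_of_aemeasurable hm hK]
  rfl

theorem qf_mem_Icc_of_measure_compl_eq_zero {ν : Measure ℝ} [IsProbabilityMeasure ν]
    {a b t : ℝ} (hab : ν (Icc a b)ᶜ = 0) (ht : t ∈ Ioo (0:ℝ) 1) : qf ν t ∈ Icc a b := by
  constructor
  · by_contra! h
    have h1 : t ≤ (ν (Iic (qf ν t))).toReal := (qf_le_iff ν ht _).1 le_rfl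
    have hsub : Iic (qf ν t) ⊆ (Icc a b)ᶜ := fun x hx hx' =>
      absurd (hx'.1.trans hx) (not_le.2 h)
    have h0 : ν (Iic (qf ν t)) = 0 := measure_mono_null hsub hab
    rw [h0] at h1
    exact absurd h1 (not_le.2 ht.1)
  · have h1 : ν (Iic b) = 1 := (prob_compl_eq_zero_iff measurableSet_Iic).1
      (measure_mono_null (compl_subset_compl.2 Icc_subset_Iic_self) hab)
    refine (qf_le_iff ν ht b).2 ?_
    rw [h1]
    exact ht.2.le

theorem upperValue_sub_lowerValue_le {ν : Measure ℝ} [IsProbabilityMeasure ν]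
    (hint : Integrable id ν) {μ : ℝ} (hμ : μ = ∫ x, x ∂ν) {a b : ℝ}
    (hab : ν (Icc a b)ᶜ = 0) (s : ℝ) : upperValue ν μ s - lowerValue ν μ s ≤ b - a := by
  rw [upperValue, lowerValue]
  split_ifs with hs
  · have hA := Afun_mem_Ioo hint hs
    have hB := Bfun_mem_Ioo hint hμ hs
    have h1 := qf_mem_Icc_of_measure_compl_eq_zero hab
      ⟨hA.1, hA.2.trans_le (nuM_mem_Icc ν μ).2⟩
    have h2 := qf_mem_Icc_of_measure_compl_eq_zero hab
      ⟨(nuP_mem_Icc ν μ).1.trans_lt hB.1, hB.2⟩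
    linarith [h1.1, h2.2]
  · have h := qf_mem_Icc_of_measure_compl_eq_zero hab
      (show (1 / 2 : ℝ) ∈ Ioo (0:ℝ) 1 by constructor <;> norm_num)
    linarith [h.1, h.2]

/-- **Proposition 2.2.** Suppose the residual distribution `F̃` of `F` has finite second
moment. Then there exist `X_i ∼ F`, `i ∈ ℕ`, and `Z ∼ F̃` such that
`Var(S_n) ≤ E[Z²]/4` for all `n`. In particular: (a) if `F` is supported on `[a,b]` then
`Var(S_n) ≤ (b−a)²/4`; (b) if `F` has finite third absolute moment then `Var(S_n) ≤ C`
for a constant `C` not depending on `n`. -/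
theorem variance_bound_construction
    (ν : Measure ℝ) [IsProbabilityMeasure ν] (μ : ℝ)
    (hint : Integrable id ν) (hμ : μ = ∫ x, x ∂ν)
    (hres : Integrable (fun x : ℝ => x ^ 2) (residualDist ν μ)) :
    ∃ (Ω : Type) (mΩ : MeasurableSpace Ω) (P : Measure Ω)
      (X : ℕ → Ω → ℝ) (Z : Ω → ℝ),
      IsProbabilityMeasure P ∧
      (∀ i, Measure.map (X i) P = ν) ∧
      Measure.map Z P = residualDist ν μ ∧
      (∀ n : ℕ,
        variance (fun ω => ∑ i ∈ Finset.range n, X i ω) P ≤ (∫ ω, (Z ω) ^ 2 ∂P) / 4) ∧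
      (∀ a b : ℝ, ν (Icc a b)ᶜ = 0 →
        ∀ n : ℕ,
          variance (fun ω => ∑ i ∈ Finset.range n, X i ω) P ≤ (b - a) ^ 2 / 4) ∧
      (Integrable (fun x : ℝ => |x| ^ (3:ℕ)) ν →
        ∃ C : ℝ, ∀ n : ℕ,
          variance (fun ω => ∑ i ∈ Finset.range n, X i ω) P ≤ C) := by
  have hprob : IsProbabilityMeasure (volume.restrict (Icc (0:ℝ) 1)) := ⟨by simp⟩
  have hHm := (continuous_Hfun hint μ).measurable
  set κ := Measure.map (Hfun ν μ) (volume.restrict (Icc (0:ℝ) 1)) with hκ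
  have hκp : IsProbabilityMeasure κ := Measure.isProbabilityMeasure_map hHm.aemeasurable
  set g : ℝ → ℝ := fun s => upperValue ν μ s - lowerValue ν μ s with hg
  have hgm : Measurable g :=
    (measurable_upperValue hint hμ).sub (measurable_lowerValue hint μ)
  have hRg : residualDist ν μ = Measure.map g κ := residualDist_eq_map hint hμ
  have hg2 : Integrable (fun s => g s ^ 2) κ := by
    rw [hRg] at hres
    exact hres.comp_measurable hgm
  obtain ⟨X, hX, hvar⟩ := exists_variance_sum_le_of_two_point_mixture κ ν μ
    (measurable_lowerValue hint μ) (measurable_upperValue hint hμ) (lowerValue_le hint μ)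
    (le_upperValue hint hμ) hg2 fun S hS => lintegral_two_point_mixture hint hμ hS
  have hZ : Measure.map (fun ω : ℝ × ℝ => g ω.1)
      (κ.prod (volume.restrict (Icc (0:ℝ) 1))) = Measure.map g κ := by
    rw [show (fun ω : ℝ × ℝ => g ω.1) = g ∘ Prod.fst from rfl,
      ← Measure.map_map hgm measurable_fst, Measure.map_fst_prod]
    simp
  have hZ2 : ∫ ω, (g ω.1) ^ 2 ∂(κ.prod (volume.restrict (Icc (0:ℝ) 1))) =
      ∫ s, g s ^ 2 ∂κ := by
    rw [integral_fun_fst (μ := κ) (fun s => g s ^ 2)]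
    simp
  refine ⟨ℝ × ℝ, inferInstance, κ.prod (volume.restrict (Icc (0:ℝ) 1)), X, fun ω => g ω.1,
    inferInstance, hX, hZ.trans hRg.symm, fun n => ?_, fun a b hab n => ?_,
    fun _ => ⟨_, hvar⟩⟩
  · rw [hZ2]
    exact hvar n
  · refine (hvar n).trans (div_le_div_of_nonneg_right ?_ (by norm_num))
    have h : ∫ s, g s ^ 2 ∂κ ≤ ∫ _, (b - a) ^ 2 ∂κ :=
      integral_mono hg2 (integrable_const _) fun s =>
        pow_le_pow_left₀ (sub_nonneg.2
          ((lowerValue_le hint μ s).trans (le_upperValue hint hμ s)))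
          (upperValue_sub_lowerValue_le hint hμ hab s) 2
    simpa using h
end

section
/- Let F be a cumulative distribution function on ℝ with mean μ and finite second moment. Then for every p ∈ (0,1) there exists a constant K, not depending on n (but possibly depending on p), such that for every n ∈ ℕ, nμ ≤ inf_{S∈𝔖_n} TVaR_p(S) ≤ nμ + K. -/
open MeasureTheory ProbabilityTheory Set Filter Topology Asymptotics

noncomputable section

/-- Extended-real-valued generalized inverse of the CDF of `ν` (so that
`F⁻¹(1) = +∞` for unbounded upper support and `F⁻¹(0) = −∞` for unbounded
lower support). -/
def qfE (ν : Measure ℝ) (t : ℝ) : EReal :=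
  if t = 0 then sInf ((fun x : ℝ => (x : EReal)) '' {x : ℝ | 0 < (ν (Iic x)).toReal})
  else sInf ((fun x : ℝ => (x : EReal)) '' {x : ℝ | t ≤ (ν (Iic x)).toReal})

/-- `μ_{p,q} = (q−p)⁻¹ ∫_p^q F⁻¹(t) dt` as an extended real number. -/
def muPQ (ν : Measure ℝ) (p q : ℝ) : EReal :=
  (((q - p)⁻¹ : ℝ) : EReal) * ((∫⁻ t in Ioo p q, ENNReal.ofReal (qf ν t) : ENNReal) : EReal)
    - (((q - p)⁻¹ : ℝ) : EReal) * ((∫⁻ t in Ioo p q, ENNReal.ofReal (-(qf ν t)) : ENNReal) : EReal)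

/-- `μ_{p,q} = (q−p)⁻¹ ∫_p^q F⁻¹(t) dt` as a real number (when it is finite). -/
def muR (ν : Measure ℝ) (p q : ℝ) : ℝ := (q - p)⁻¹ * ∫ t in Ioo p q, qf ν t

/-- Value-at-Risk of a random variable `X` at level `p`:
`VaR_p(X) = inf {x | P(X ≤ x) ≥ p}`. -/
def VaR {Ω : Type*} [MeasurableSpace Ω] (P : Measure Ω) (X : Ω → ℝ) (p : ℝ) : ℝ :=
  sInf {x : ℝ | p ≤ (P {ω | X ω ≤ x}).toReal}

/-- Expected Shortfall / Tail-Value-at-Risk at level `p`: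
`TVaR_p(X) = (1−p)⁻¹ ∫_p^1 VaR_α(X) dα` (real-valued). -/
def TVaR {Ω : Type*} [MeasurableSpace Ω] (P : Measure Ω) (X : Ω → ℝ) (p : ℝ) : ℝ :=
  (1 - p)⁻¹ * ∫ α in p..(1:ℝ), VaR P X α

/-- Extended-real-valued Tail-Value-at-Risk at level `p`, allowing the value `+∞`. -/
def TVaRE {Ω : Type*} [MeasurableSpace Ω] (P : Measure Ω) (X : Ω → ℝ) (p : ℝ) : EReal :=
  (((1 - p)⁻¹ : ℝ) : EReal) * ((∫⁻ α in Ioo p 1, ENNReal.ofReal (VaR P X α) : ENNReal) : EReal)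
    - (((1 - p)⁻¹ : ℝ) : EReal) * ((∫⁻ α in Ioo p 1, ENNReal.ofReal (-(VaR P X α)) : ENNReal) : EReal)

/-- The set of values `VaR_p(S)` for `S` in the admissible risk class
`𝔖_n(F,…,F) = {X₁ + ⋯ + X_n : X_i ∼ F}` (over all atomless probability spaces). -/
def VaRvals (ν : Measure ℝ) (n : ℕ) (p : ℝ) : Set ℝ :=
  {r | ∃ (Ω : Type) (mΩ : MeasurableSpace Ω) (P : Measure Ω) (X : Fin n → Ω → ℝ),
    IsProbabilityMeasure P ∧ (∀ i, Measure.map (X i) P = ν) ∧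
    r = VaR P (fun ω => ∑ i, X i ω) p}

/-- The set of values `TVaR_p(S)` for `S` in the admissible risk class
`𝔖_n(F,…,F) = {X₁ + ⋯ + X_n : X_i ∼ F}` (over all atomless probability spaces). -/
def TVaRvals (ν : Measure ℝ) (n : ℕ) (p : ℝ) : Set ℝ :=
  {r | ∃ (Ω : Type) (mΩ : MeasurableSpace Ω) (P : Measure Ω) (X : Fin n → Ω → ℝ),
    IsProbabilityMeasure P ∧ (∀ i, Measure.map (X i) P = ν) ∧
    r = TVaR P (fun ω => ∑ i, X i ω) p}

end

section Quantile

variable {Ω : Type*} [MeasurableSpace Ω] {P : Measure Ω} [IsProbabilityMeasure P] {X : Ω → ℝ}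

theorem VaR_le_iff (hX : AEMeasurable X P) {t : ℝ} (ht : t ∈ Ioo (0 : ℝ) 1) (x : ℝ) :
    VaR P X t ≤ x ↔ t ≤ cdf (P.map X) x := by
  have := Measure.isProbabilityMeasure_map hX
  have hset : {x : ℝ | t ≤ (P {ω | X ω ≤ x}).toReal} = {x : ℝ | t ≤ cdf (P.map X) x} := by
    ext y
    simp only [mem_ofPred_eq, cdf_eq_real, Measure.real,
      Measure.map_apply_of_aemeasurable hX measurableSet_Iic]
    rfl
  have hne : {x : ℝ | t ≤ cdf (P.map X) x}.Nonempty :=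
    ((tendsto_cdf_atTop (P.map X)).eventually_const_le ht.2).exists
  have hbdd : BddBelow {x : ℝ | t ≤ cdf (P.map X) x} := by
    obtain ⟨b, hb⟩ := ((tendsto_cdf_atBot (P.map X)).eventually_lt_const ht.1).exists
    refine ⟨b, fun y hy => ?_⟩
    by_contra! hlt
    exact (hb.trans_le hy).not_ge (monotone_cdf _ hlt.le)
  rw [VaR, hset]
  refine ⟨fun h => ?_, fun h => csInf_le hbdd h⟩
  have hright : Tendsto (cdf (P.map X)) (𝓝[>] x) (𝓝 (cdf (P.map X) x)) :=
    ((cdf (P.map X)).right_continuous x).tendsto.mono_left (nhdsWithin_mono _ Ioi_subset_Ici_self)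
  refine ge_of_tendsto hright ?_
  filter_upwards [self_mem_nhdsWithin] with y hy
  obtain ⟨z, hz, hzy⟩ := exists_lt_of_csInf_lt hne (h.trans_lt hy)
  exact le_trans hz (monotone_cdf _ hzy.le)

theorem monotoneOn_VaR (hX : AEMeasurable X P) : MonotoneOn (VaR P X) (Ioo 0 1) := by
  intro s hs t ht hst
  rw [VaR_le_iff hX hs]
  exact hst.trans ((VaR_le_iff hX ht _).1 le_rfl)

theorem aemeasurable_VaR (hX : AEMeasurable X P) :
    AEMeasurable (VaR P X) (volume.restrict (Ioo 0 1)) :=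
  aemeasurable_restrict_of_monotoneOn measurableSet_Ioo (monotoneOn_VaR hX)

theorem map_VaR (hX : AEMeasurable X P) :
    (volume.restrict (Ioo (0 : ℝ) 1)).map (VaR P X) = P.map X := by
  have := Measure.isProbabilityMeasure_map hX
  refine (Measure.ext_of_Iic _ _ fun a => ?_).symm
  rw [Measure.map_apply_of_aemeasurable (aemeasurable_VaR hX) measurableSet_Iic,
    Measure.restrict_apply' measurableSet_Ioo]
  have hset : VaR P X ⁻¹' Iic a ∩ Ioo 0 1 = Ioo 0 1 ∩ Iic (cdf (P.map X) a) := by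
    ext t
    simp only [mem_inter_iff, mem_preimage, mem_Iic]
    rw [and_comm]
    exact and_congr_right fun ht => VaR_le_iff hX ht a
  rw [hset, ← ofReal_cdf]
  have h0 := cdf_nonneg (P.map X) a
  have h1 := cdf_le_one (P.map X) a
  set c := cdf (P.map X) a
  refine le_antisymm ?_ ?_
  · calc ENNReal.ofReal c = volume (Ioo 0 c) := by simp
      _ ≤ volume (Ioo 0 1 ∩ Iic c) :=
        measure_mono fun t ht => ⟨⟨ht.1, ht.2.trans_le h1⟩, ht.2.le⟩
  · calc volume (Ioo 0 1 ∩ Iic c) ≤ volume (Ioc 0 c) :=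
        measure_mono fun t ht => ⟨ht.1.1, ht.2⟩
      _ = _ := by simp

theorem integrable_VaR (hX : Integrable X P) :
    IntegrableOn (VaR P X) (Ioo 0 1) := by
  have h := aemeasurable_VaR hX.aemeasurable
  have h1 : Integrable (id : ℝ → ℝ) (P.map X) :=
    (integrable_map_measure aestronglyMeasurable_id hX.aemeasurable).2 hX
  rw [← map_VaR hX.aemeasurable] at h1
  exact (integrable_map_measure aestronglyMeasurable_id h).1 h1

theorem setIntegral_comp_VaR (hX : AEMeasurable X P) {f : ℝ → ℝ} (hf : Continuous f) :
    ∫ α in Ioo 0 1, f (VaR P X α) = ∫ ω, f (X ω) ∂P := by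
  rw [← integral_map (aemeasurable_VaR hX) hf.aestronglyMeasurable, map_VaR hX,
    integral_map hX hf.aestronglyMeasurable]

theorem intervalIntegrable_VaR (hX : Integrable X P) {a b : ℝ} (ha : 0 ≤ a) (hab : a ≤ b)
    (hb : b ≤ 1) : IntervalIntegrable (VaR P X) volume a b := by
  rw [intervalIntegrable_iff_integrableOn_Ioo_of_le hab]
  exact (integrable_VaR hX).mono_set (Ioo_subset_Ioo ha hb)

theorem integral_le_TVaR (hX : Integrable X P) {p : ℝ} (hp : p ∈ Ioo (0 : ℝ) 1) :
    ∫ ω, X ω ∂P ≤ TVaR P X p := by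
  have hmono := monotoneOn_VaR hX.aemeasurable
  have i1 := intervalIntegrable_VaR hX le_rfl hp.1.le hp.2.le
  have i2 := intervalIntegrable_VaR hX hp.1.le hp.2.le le_rfl
  have hlow : ∫ α in (0 : ℝ)..p, VaR P X α ≤ ∫ _α in (0 : ℝ)..p, VaR P X p :=
    intervalIntegral.integral_mono_on_of_le_Ioo hp.1.le i1 intervalIntegrable_const
      fun t ht => hmono ⟨ht.1, ht.2.trans hp.2⟩ hp ht.2.le
  have hupp : ∫ _α in p..(1 : ℝ), VaR P X p ≤ ∫ α in p..(1 : ℝ), VaR P X α :=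
    intervalIntegral.integral_mono_on_of_le_Ioo hp.2.le intervalIntegrable_const i2
      fun t ht => hmono hp ⟨hp.1.trans ht.1, ht.2⟩ ht.1.le
  simp only [intervalIntegral.integral_const, smul_eq_mul, sub_zero] at hlow hupp
  have hsum := intervalIntegral.integral_add_adjacent_intervals i1 i2
  have htot : ∫ α in (0 : ℝ)..1, VaR P X α = ∫ ω, X ω ∂P := by
    rw [intervalIntegral.integral_of_le zero_le_one, integral_Ioc_eq_integral_Ioo]
    exact setIntegral_comp_VaR hX.aemeasurable continuous_id
  have hp1 : 0 < 1 - p := sub_pos.2 hp.2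
  rw [TVaR, ← div_eq_inv_mul, le_div_iff₀ hp1, ← htot, ← hsum]
  nlinarith [mul_le_mul_of_nonneg_left hlow hp1.le, mul_le_mul_of_nonneg_left hupp hp.1.le]

theorem TVaR_le_add_integral_abs_sub (hX : Integrable X P) {p : ℝ} (hp : p ∈ Ioo (0 : ℝ) 1)
    (m : ℝ) : TVaR P X p ≤ m + (1 - p)⁻¹ * ∫ ω, |X ω - m| ∂P := by
  have i2 := intervalIntegrable_VaR hX hp.1.le hp.2.le le_rfl
  have hp1 : 0 < 1 - p := sub_pos.2 hp.2
  have habs : IntegrableOn (fun α => |VaR P X α - m|) (Ioo 0 1) :=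
    ((integrable_VaR hX).sub (integrable_const m)).abs
  have key : ∫ α in p..(1 : ℝ), (VaR P X α - m) ≤ ∫ ω, |X ω - m| ∂P := by
    rw [← setIntegral_comp_VaR hX.aemeasurable (f := fun x => |x - m|) (by fun_prop),
      intervalIntegral.integral_of_le hp.2.le, integral_Ioc_eq_integral_Ioo]
    have hsub : Ioo p 1 ⊆ Ioo (0 : ℝ) 1 := Ioo_subset_Ioo_left hp.1.le
    refine (integral_mono (((integrable_VaR hX).mono_set hsub).sub (integrable_const m))
      (habs.mono_set hsub) fun t => le_abs_self _).trans ?_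
    exact setIntegral_mono_set habs (ae_of_all _ fun _ => abs_nonneg _) hsub.eventuallyLE
  rw [intervalIntegral.integral_sub i2 intervalIntegrable_const] at key
  simp only [intervalIntegral.integral_const, smul_eq_mul] at key
  rw [TVaR]
  have : (1 - p)⁻¹ * ((1 - p) * m) = m := inv_mul_cancel_left₀ hp1.ne' m
  have := mul_le_mul_of_nonneg_left key (inv_pos.2 hp1).le
  linarith

end Quantile

section SystematicSampling

theorem integral_floor_add (a : ℝ) : ∫ u in (0 : ℝ)..1, (⌊u + a⌋ : ℝ) = a := by
  have hper : Function.Periodic (fun u : ℝ => Int.fract u) 1 := fun u => Int.fract_add_one u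
  have hfi : ∀ s t : ℝ, IntervalIntegrable (fun u : ℝ => Int.fract u) volume s t := fun s t => by
    refine (intervalIntegrable_const (c := (1 : ℝ))).mono_fun
      measurable_fract.aestronglyMeasurable (ae_of_all _ fun u => ?_)
    simpa [abs_of_nonneg (Int.fract_nonneg u)] using (Int.fract_lt_one u).le
  have hfract : ∫ u in a..(a + 1), Int.fract u = 1 / 2 := by
    rw [hper.intervalIntegral_add_eq a 0, zero_add,
      intervalIntegral.integral_of_le zero_le_one, integral_Ioc_eq_integral_Ioo,
      setIntegral_congr_fun measurableSet_Ioo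
        (fun u hu => Int.fract_eq_self.2 ⟨hu.1.le, hu.2⟩ : EqOn _ (fun u : ℝ => u) _),
      ← integral_Ioc_eq_integral_Ioo, ← intervalIntegral.integral_of_le zero_le_one, integral_id]
    norm_num
  rw [intervalIntegral.integral_comp_add_right (fun u : ℝ => (⌊u⌋ : ℝ)), zero_add, add_comm 1 a]
  have hfloor : (fun u : ℝ => (⌊u⌋ : ℝ)) = fun u => u - Int.fract u :=
    funext fun u => (Int.self_sub_fract u).symm
  rw [hfloor, intervalIntegral.integral_sub intervalIntegral.intervalIntegrable_id (hfi _ _),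
    hfract, integral_id]
  ring

/-- The increment over a step of length `θ` of the floor function, read at the random phase `u`. -/
noncomputable def floorStep (a θ u : ℝ) : ℤ := ⌊u + (a + θ)⌋ - ⌊u + a⌋

theorem floorStep_eq_zero_or_one {θ : ℝ} (h0 : 0 ≤ θ) (h1 : θ ≤ 1) (a u : ℝ) :
    floorStep a θ u = 0 ∨ floorStep a θ u = 1 := by
  have hlow : ⌊u + a⌋ ≤ ⌊u + (a + θ)⌋ := Int.floor_le_floor (by linarith)
  have hupp : ⌊u + (a + θ)⌋ ≤ ⌊u + a⌋ + 1 := by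
    rw [← Int.floor_add_one]
    exact Int.floor_le_floor (by linarith)
  unfold floorStep
  omega

theorem measurable_floorStep (a θ : ℝ) : Measurable (floorStep a θ) := by
  unfold floorStep
  exact (measurable_id.add_const _).floor.sub (measurable_id.add_const _).floor

instance isProbabilityMeasure_restrict_Ioo_zero_one :
    IsProbabilityMeasure (volume.restrict (Ioo (0 : ℝ) 1)) := ⟨by simp⟩

theorem measure_floorStep_eq_one {θ : ℝ} (h0 : 0 ≤ θ) (h1 : θ ≤ 1) (a : ℝ) :
    volume.restrict (Ioo (0 : ℝ) 1) {u | floorStep a θ u = 1} = ENNReal.ofReal θ := by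
  have hm : MeasurableSet {u | floorStep a θ u = 1} :=
    measurable_floorStep a θ (measurableSet_singleton 1)
  have hind : (fun u => (floorStep a θ u : ℝ)) = {u | floorStep a θ u = 1}.indicator 1 := by
    funext u
    rcases floorStep_eq_zero_or_one h0 h1 a u with h | h <;> simp [indicator, h]
  have hfi : ∀ b : ℝ, IntervalIntegrable (fun u : ℝ => (⌊u + b⌋ : ℝ)) volume 0 1 := fun b =>
    Monotone.intervalIntegrable fun s t hst => by
      exact_mod_cast Int.floor_le_floor (by linarith : s + b ≤ t + b)
  have hint : ∫ u in Ioo (0 : ℝ) 1, (floorStep a θ u : ℝ) = θ := by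
    rw [← integral_Ioc_eq_integral_Ioo, ← intervalIntegral.integral_of_le zero_le_one]
    simp only [floorStep, Int.cast_sub]
    rw [intervalIntegral.integral_sub (hfi _) (hfi _), integral_floor_add, integral_floor_add]
    ring
  rw [hind, integral_indicator_one hm] at hint
  exact (ofReal_measureReal (measure_ne_top _ _)).symm.trans (congrArg ENNReal.ofReal hint)

theorem measure_floorStep_eq_zero {θ : ℝ} (h0 : 0 ≤ θ) (h1 : θ ≤ 1) (a : ℝ) :
    volume.restrict (Ioo (0 : ℝ) 1) {u | floorStep a θ u = 0} = ENNReal.ofReal (1 - θ) := by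
  have hm : MeasurableSet {u | floorStep a θ u = 1} :=
    measurable_floorStep a θ (measurableSet_singleton 1)
  have hcompl : {u | floorStep a θ u = 0} = {u | floorStep a θ u = 1}ᶜ := by
    ext u
    rcases floorStep_eq_zero_or_one h0 h1 a u with h | h <;> simp [h]
  rw [hcompl, prob_compl_eq_one_sub hm, measure_floorStep_eq_one h0 h1,
    ENNReal.ofReal_sub _ h0, ENNReal.ofReal_one]

theorem measure_two_point_floorStep {θ : ℝ} (h0 : 0 ≤ θ) (h1 : θ ≤ 1) (a x y : ℝ) (A : Set ℝ) :
    volume.restrict (Ioo (0 : ℝ) 1) {u | x + (y - x) * floorStep a θ u ∈ A} =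
      ENNReal.ofReal (1 - θ) * A.indicator 1 x + ENNReal.ofReal θ * A.indicator 1 y := by
  have hpre : {u | x + (y - x) * floorStep a θ u ∈ A} =
      {u | floorStep a θ u = 0 ∧ x ∈ A} ∪ {u | floorStep a θ u = 1 ∧ y ∈ A} := by
    ext u
    rcases floorStep_eq_zero_or_one h0 h1 a u with h | h <;> simp [h]
  have hm : MeasurableSet {u | floorStep a θ u = 1 ∧ y ∈ A} :=
    (measurable_floorStep a θ (measurableSet_singleton 1)).inter (MeasurableSet.const _)
  rw [hpre, measure_union (disjoint_left.2 fun u hu hv => by simp_all) hm]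
  by_cases hx : x ∈ A <;> by_cases hy : y ∈ A <;>
    simp [hx, hy, measure_floorStep_eq_one h0 h1, measure_floorStep_eq_zero h0 h1]

theorem sum_floorStep (θ u : ℝ) (n : ℕ) :
    ∑ i : Fin n, floorStep (i * θ) θ u = ⌊u + n * θ⌋ - ⌊u⌋ := by
  rw [Fin.sum_univ_eq_sum_range (fun i => floorStep (i * θ) θ u)]
  have hstep : ∀ i : ℕ, floorStep (i * θ) θ u = ⌊u + (i + 1 : ℕ) * θ⌋ - ⌊u + i * θ⌋ := fun i => by
    rw [floorStep, Nat.cast_add_one, add_one_mul]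
  simp only [hstep]
  rw [Finset.sum_range_sub (fun i : ℕ => ⌊u + i * θ⌋)]
  simp

theorem abs_sum_floorStep_sub_le (θ u : ℝ) (n : ℕ) :
    |((∑ i : Fin n, floorStep (i * θ) θ u : ℤ) : ℝ) - n * θ| ≤ 1 := by
  rw [sum_floorStep, Int.cast_sub, abs_le]
  have := Int.floor_le u
  have := Int.lt_floor_add_one u
  have := Int.floor_le (u + n * θ)
  have := Int.lt_floor_add_one (u + n * θ)
  constructor <;> linarith

end SystematicSampling

section Coupling

variable {ν : Measure ℝ} [IsProbabilityMeasure ν]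

theorem lintegral_ofReal_sub_comm (h : Integrable (fun x : ℝ => x) ν) :
    ∫⁻ x, ENNReal.ofReal (∫ x, x ∂ν - x) ∂ν = ∫⁻ x, ENNReal.ofReal (x - ∫ x, x ∂ν) ∂ν := by
  set m := ∫ x, x ∂ν with hm
  have hi : Integrable (fun x => x - m) ν := h.sub (integrable_const m)
  have hzero : ∫ x, (x - m) ∂ν = 0 := by
    rw [integral_sub h (integrable_const m)]
    simp [hm]
  have hpos : ∫⁻ x, ENNReal.ofReal (x - m) ∂ν ≠ ⊤ := hi.lintegral_lt_top.ne
  have hneg : ∫⁻ x, ENNReal.ofReal (-(x - m)) ∂ν ≠ ⊤ := hi.neg.lintegral_lt_top.ne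
  rw [integral_eq_lintegral_pos_part_sub_lintegral_neg_part hi, sub_eq_zero,
    ENNReal.toReal_eq_toReal_iff' hpos hneg] at hzero
  simpa using hzero.symm

/-- A distribution is a mixture of two-point distributions with the same mean, and the distance
between the two points is integrable when the second moment is finite. -/
theorem exists_two_point_mixture {m : ℝ} (hmom : Integrable (fun x : ℝ => x ^ 2) ν)
    (hm : m = ∫ x, x ∂ν) :
    ∃ Q : Measure (ℝ × ℝ), SFinite Q ∧ (∀ᵐ z ∂Q, z.1 ≤ m ∧ m < z.2) ∧
      (∀ A : Set ℝ, MeasurableSet A →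
        ∫⁻ z, (ENNReal.ofReal (1 - (m - z.1) / (z.2 - z.1)) * A.indicator 1 z.1 +
          ENNReal.ofReal ((m - z.1) / (z.2 - z.1)) * A.indicator 1 z.2) ∂Q = ν A) ∧
      ∫⁻ z, ENNReal.ofReal (z.2 - z.1) ∂Q ≠ ⊤ := by
  have hid : Integrable (fun x : ℝ => x) ν :=
    ((memLp_two_iff_integrable_sq aestronglyMeasurable_id).2 hmom).integrable one_le_two
  have hcomm := lintegral_ofReal_sub_comm hid
  rw [← hm] at hcomm
  set C := ∫⁻ x, ENNReal.ofReal (x - m) ∂ν with hC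
  have hCtop : C ≠ ⊤ := (hid.sub (integrable_const m)).lintegral_lt_top.ne
  have hmeas1 : Measurable fun x : ℝ => ENNReal.ofReal (x - m) := by fun_prop
  have hmeas2 : Measurable fun x : ℝ => ENNReal.ofReal (m - x) := by fun_prop
  by_cases hC0 : C = 0
  · have hν : ν = Measure.dirac m := by
      have hae : (id : ℝ → ℝ) =ᵐ[ν] fun _ => m := by
        filter_upwards [(lintegral_eq_zero_iff hmeas1).1 (hC.symm.trans hC0),
          (lintegral_eq_zero_iff hmeas2).1 (hcomm.trans hC0)] with x h1 h2
        simp only [Pi.zero_apply, ENNReal.ofReal_eq_zero] at h1 h2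
        exact le_antisymm (by simpa using h1) (by simpa using h2)
      rw [← Measure.map_id (μ := ν), Measure.map_congr hae, Measure.map_const]
      simp
    refine ⟨Measure.dirac (m, m + 1), inferInstance, ?_, fun A hA => ?_, ?_⟩
    · simp [ae_dirac_eq]
    · rw [lintegral_dirac, hν, Measure.dirac_apply' _ hA]
      simp
    · simp [lintegral_dirac]
  · set w : ℝ × ℝ → ENNReal :=
      (Iic m ×ˢ Ioi m).indicator fun z => C⁻¹ * ENNReal.ofReal (z.2 - z.1) with hw
    have hwm : Measurable w :=
      Measurable.indicator (by fun_prop) (measurableSet_Iic.prod measurableSet_Ioi)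
    refine ⟨(ν.prod ν).withDensity w, inferInstance, ?_, fun A hA => ?_, ?_⟩
    · rw [ae_withDensity_iff hwm]
      refine ae_of_all _ fun z hz => ?_
      have := mem_of_indicator_ne_zero hz
      exact this
    · have hpt : ∀ z : ℝ × ℝ,
          w z * (ENNReal.ofReal (1 - (m - z.1) / (z.2 - z.1)) * A.indicator 1 z.1 +
            ENNReal.ofReal ((m - z.1) / (z.2 - z.1)) * A.indicator 1 z.2) =
          C⁻¹ * ((A ∩ Iic m).indicator 1 z.1 * ENNReal.ofReal (z.2 - m) +
            ENNReal.ofReal (m - z.1) * (A ∩ Ioi m).indicator 1 z.2) := by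
        rintro ⟨x, y⟩
        by_cases hx : x ≤ m
        · by_cases hy : m < y
          · have hxy : 0 < y - x := by linarith
            have h1 : ENNReal.ofReal (y - x) * ENNReal.ofReal (1 - (m - x) / (y - x)) =
                ENNReal.ofReal (y - m) := by
              rw [← ENNReal.ofReal_mul hxy.le]
              congr 1
              field_simp
              ring
            have h2 : ENNReal.ofReal (y - x) * ENNReal.ofReal ((m - x) / (y - x)) =
                ENNReal.ofReal (m - x) := by
              rw [← ENNReal.ofReal_mul hxy.le, mul_div_cancel₀ _ hxy.ne']
            have hwz : w (x, y) = C⁻¹ * ENNReal.ofReal (y - x) :=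
              indicator_of_mem (show (x, y) ∈ Iic m ×ˢ Ioi m from ⟨hx, hy⟩) _
            have hA1 : (A ∩ Iic m).indicator (1 : ℝ → ENNReal) x = A.indicator 1 x := by
              by_cases hxA : x ∈ A <;> simp [hx, hxA]
            have hA2 : (A ∩ Ioi m).indicator (1 : ℝ → ENNReal) y = A.indicator 1 y := by
              by_cases hyA : y ∈ A <;> simp [hy, hyA]
            simp only [hwz, hA1, hA2]
            rw [← h1, ← h2]
            ring
          · simp [hw, indicator, hy, ENNReal.ofReal_of_nonpos (sub_nonpos.2 (not_lt.1 hy))]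
        · simp [hw, indicator, hx,
            ENNReal.ofReal_of_nonpos (sub_nonpos.2 (not_le.1 hx).le)]
      have hA1 : Measurable ((A ∩ Iic m).indicator (1 : ℝ → ENNReal)) :=
        measurable_one.indicator (hA.inter measurableSet_Iic)
      have hA2 : Measurable ((A ∩ Ioi m).indicator (1 : ℝ → ENNReal)) :=
        measurable_one.indicator (hA.inter measurableSet_Ioi)
      have hAi : Measurable (A.indicator (1 : ℝ → ENNReal)) := measurable_one.indicator hA
      rw [lintegral_withDensity_eq_lintegral_mul _ hwm (by fun_prop)]
      simp only [Pi.mul_apply, hpt]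
      rw [lintegral_const_mul _ (by fun_prop), lintegral_add_left (by fun_prop),
        lintegral_prod_mul hA1.aemeasurable hmeas1.aemeasurable,
        lintegral_prod_mul hmeas2.aemeasurable hA2.aemeasurable, hcomm, ← hC,
        lintegral_indicator_one (hA.inter measurableSet_Iic),
        lintegral_indicator_one (hA.inter measurableSet_Ioi), mul_comm C, ← add_mul,
        mul_comm, mul_assoc, ENNReal.mul_inv_cancel hC0 hCtop, mul_one,
        ← compl_Iic, ← Set.sdiff_eq, measure_inter_add_sdiff A measurableSet_Iic]
    · rw [lintegral_withDensity_eq_lintegral_mul _ hwm (by fun_prop)]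
      have hsq : Integrable (fun z : ℝ × ℝ => 2 * z.1 ^ 2 + 2 * z.2 ^ 2) (ν.prod ν) :=
        ((hmom.comp_fst ν).const_mul 2).add ((hmom.comp_snd ν).const_mul 2)
      refine ne_top_of_le_ne_top
        (ENNReal.mul_ne_top (ENNReal.inv_ne_top.2 hC0) hsq.lintegral_lt_top.ne) ?_
      rw [← lintegral_const_mul _ (by fun_prop)]
      refine lintegral_mono fun z => ?_
      by_cases hz : z ∈ Iic m ×ˢ Ioi m
      · have hz0 : 0 ≤ z.2 - z.1 := sub_nonneg.2 (hz.1.trans hz.2.le)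
        rw [Pi.mul_apply, hw, indicator_of_mem hz, mul_assoc, ← ENNReal.ofReal_mul hz0]
        gcongr
        nlinarith [sq_nonneg (z.1 + z.2)]
      · rw [Pi.mul_apply, hw, indicator_of_notMem hz, zero_mul]
        exact zero_le

/-- Systematic sampling within the two-point components of a distribution yields sums whose
mean absolute deviation is bounded uniformly in the number of summands. -/
theorem exists_coupling_integral_abs_sub_le {m : ℝ} (hmom : Integrable (fun x : ℝ => x ^ 2) ν)
    (hm : m = ∫ x, x ∂ν) :
    ∃ K : ℝ, ∀ n : ℕ, ∃ (P : Measure ((ℝ × ℝ) × ℝ)) (X : Fin n → (ℝ × ℝ) × ℝ → ℝ),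
      IsProbabilityMeasure P ∧ (∀ i, P.map (X i) = ν) ∧
      ∫ ω, |∑ i, X i ω - n * m| ∂P ≤ K := by
  obtain ⟨Q, hQs, hQ, hlaw, hfin⟩ := exists_two_point_mixture hmom hm
  set θ : ℝ × ℝ → ℝ := fun z => (m - z.1) / (z.2 - z.1) with hθ
  set Y : ℕ → (ℝ × ℝ) × ℝ → ℝ :=
    fun i ω => ω.1.1 + (ω.1.2 - ω.1.1) * floorStep (i * θ ω.1) (θ ω.1) ω.2 with hY
  have hYm : ∀ i, Measurable (Y i) := fun i => by
    have hθm : Measurable θ := by fun_prop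
    have hf : Measurable fun ω : (ℝ × ℝ) × ℝ => floorStep (i * θ ω.1) (θ ω.1) ω.2 := by
      unfold floorStep
      exact Measurable.sub (Measurable.floor (by fun_prop)) (Measurable.floor (by fun_prop))
    have hf' : Measurable fun ω : (ℝ × ℝ) × ℝ => (floorStep (i * θ ω.1) (θ ω.1) ω.2 : ℝ) :=
      (measurable_of_countable (fun k : ℤ => (k : ℝ))).comp hf
    fun_prop
  set P := Q.prod (volume.restrict (Ioo (0 : ℝ) 1)) with hP
  have hmap : ∀ i, P.map (Y i) = ν := fun i => by
    ext A hA
    rw [Measure.map_apply (hYm i) hA, Measure.prod_apply (hYm i hA), ← hlaw A hA]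
    refine lintegral_congr_ae ?_
    filter_upwards [hQ] with z hz
    have hz0 : 0 < z.2 - z.1 := sub_pos.2 (hz.1.trans_lt hz.2)
    have h0 : 0 ≤ θ z := div_nonneg (sub_nonneg.2 hz.1) hz0.le
    have h1 : θ z ≤ 1 := (div_le_one hz0).2 (by linarith [hz.2])
    exact measure_two_point_floorStep h0 h1 (i * θ z) z.1 z.2 A
  have hPprob : IsProbabilityMeasure P := by
    refine ⟨?_⟩
    rw [← preimage_univ (f := Y 0), ← Measure.map_apply (hYm 0) MeasurableSet.univ, hmap 0,
      measure_univ]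
  refine ⟨(∫⁻ z, ENNReal.ofReal (z.2 - z.1) ∂Q).toReal, fun n =>
    ⟨P, fun i => Y i, hPprob, fun i => hmap i, ?_⟩⟩
  have hSm : Measurable fun ω => ∑ i : Fin n, Y i ω :=
    Finset.measurable_sum _ fun i _ => hYm i
  rw [integral_eq_lintegral_of_nonneg_ae (ae_of_all _ fun _ => abs_nonneg _)
    (hSm.sub_const _).abs.aestronglyMeasurable]
  refine ENNReal.toReal_mono hfin ?_
  rw [hP, lintegral_prod _ (hSm.sub_const _).abs.ennreal_ofReal.aemeasurable]
  refine lintegral_mono_ae ?_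
  filter_upwards [hQ] with z hz
  have hz0 : 0 < z.2 - z.1 := sub_pos.2 (hz.1.trans_lt hz.2)
  have hbound : ∀ u, |∑ i : Fin n, Y i (z, u) - n * m| ≤ z.2 - z.1 := fun u => by
    have hmθ : (z.2 - z.1) * θ z = m - z.1 := mul_div_cancel₀ _ hz0.ne'
    have hsum : ∑ i : Fin n, Y i (z, u) - n * m = (z.2 - z.1) *
        (((∑ i : Fin n, floorStep (i * θ z) (θ z) u : ℤ) : ℝ) - n * θ z) := by
      simp only [hY, Finset.sum_add_distrib, ← Finset.mul_sum, Finset.sum_const,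
        Finset.card_univ, Fintype.card_fin, nsmul_eq_mul, Int.cast_sum]
      linear_combination (n : ℝ) * hmθ
    rw [hsum, abs_mul, abs_of_pos hz0]
    exact mul_le_of_le_one_right hz0.le (abs_sum_floorStep_sub_le _ _ _)
  calc _ ≤ ∫⁻ _u in Ioo (0 : ℝ) 1, ENNReal.ofReal (z.2 - z.1) :=
        lintegral_mono fun u => ENNReal.ofReal_le_ofReal (hbound u)
    _ = _ := by simp

theorem integrable_of_map_eq {Ω : Type*} [MeasurableSpace Ω] {P : Measure Ω} {X : Ω → ℝ}
    (hX : P.map X = ν) (hid : Integrable (fun x : ℝ => x) ν) : Integrable X P := by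
  have hXm : AEMeasurable X P :=
    AEMeasurable.of_map_ne_zero (hX ▸ IsProbabilityMeasure.ne_zero ν)
  rw [← hX] at hid
  exact (integrable_map_measure aestronglyMeasurable_id hXm).1 hid

theorem integral_sum_of_map_eq {Ω : Type*} [MeasurableSpace Ω] {P : Measure Ω} {n : ℕ}
    {X : Fin n → Ω → ℝ} (hX : ∀ i, P.map (X i) = ν) (hid : Integrable (fun x : ℝ => x) ν) :
    ∫ ω, ∑ i, X i ω ∂P = n * ∫ x, x ∂ν := by
  have hXi : ∀ i, ∫ ω, X i ω ∂P = ∫ x, x ∂ν := fun i => by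
    conv_rhs => rw [← hX i]
    exact (integral_map (integrable_of_map_eq (hX i) hid).aemeasurable
      aestronglyMeasurable_id).symm
  rw [integral_finsetSum _ fun i _ => integrable_of_map_eq (hX i) hid]
  simp [hXi]

end Coupling

/-- **Corollary 3.2 (b).** If `F` has mean `μ` and finite second moment, then for each
`p ∈ (0,1)` there is a constant `K` not depending on `n` such that
`nμ ≤ inf_{S ∈ 𝔖_n} TVaR_p(S) ≤ nμ + K` for every `n`. -/
theorem inf_TVaR_bounds_second_moment
    (ν : Measure ℝ) [IsProbabilityMeasure ν] (μ : ℝ)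
    (hmom : Integrable (fun x : ℝ => x ^ 2) ν) (hμ : μ = ∫ x, x ∂ν)
    (p : ℝ) (hp : p ∈ Ioo (0:ℝ) 1) :
    ∃ K : ℝ, ∀ n : ℕ, 0 < n →
      (n : ℝ) * μ ≤ sInf (TVaRvals ν n p) ∧
      sInf (TVaRvals ν n p) ≤ (n : ℝ) * μ + K := by
  have hid : Integrable (fun x : ℝ => x) ν :=
    ((memLp_two_iff_integrable_sq aestronglyMeasurable_id).2 hmom).integrable one_le_two
  have hlow : ∀ n : ℕ, ∀ r ∈ TVaRvals ν n p, (n : ℝ) * μ ≤ r := by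
    rintro n r ⟨Ω, mΩ, P, X, hP, hX, rfl⟩
    rw [hμ, ← integral_sum_of_map_eq hX hid]
    exact integral_le_TVaR (integrable_finsetSum _ fun i _ => integrable_of_map_eq (hX i) hid) hp
  obtain ⟨K, hK⟩ := exists_coupling_integral_abs_sub_le hmom hμ
  refine ⟨(1 - p)⁻¹ * K, fun n _ => ?_⟩
  obtain ⟨P, X, hP, hX, hPX⟩ := hK n
  have hmem : TVaR P (fun ω => ∑ i, X i ω) p ∈ TVaRvals ν n p :=
    ⟨(ℝ × ℝ) × ℝ, inferInstance, P, X, hP, hX, rfl⟩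
  refine ⟨le_csInf ⟨_, hmem⟩ (hlow n), (csInf_le ⟨_, hlow n⟩ hmem).trans ?_⟩
  refine (TVaR_le_add_integral_abs_sub
    (integrable_finsetSum _ fun i _ => integrable_of_map_eq (hX i) hid) hp (n * μ)).trans ?_
  have := inv_nonneg.2 (sub_nonneg.2 hp.2.le)
  gcongr
end
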